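/- arXiv:2311.06540 — 6 statements merged into one kernel-verified Lean document; each statement's English description precedes it below -/
import Mathlib

section
/- Let E ⊇ F be fields, M a Lie E-algebra of maximal class, and L = ⊕_{i≥1} L_i the Lie F-subalgebra of M generated by a finite-dimensional F-subspace L_1 of M_1 such that E·L_1 = M_1; assume the 2-step field K of L is a finite extension of F. If L is ideally constrained (i.e. ideally 1-constrained), then dim_F L_i = [K : F] for every i ≥ 3, and F_i = K for every i ≥ 2. -/
set_option synthInstance.maxHeartbeats 1000000
set_option maxHeartbeats 1000000

section Defs

variable (R : Type*) [Field R] {M : Type*} [LieRing M] [Module R M]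

/-- The graded pieces of the Lie subalgebra generated in degree 1 by `L1`:
`gradedPieces R L1 1 = L1` and `gradedPieces R L1 (i+1) = [gradedPieces R L1 i, L1]`. -/
def gradedPieces (L1 : Submodule R M) : ℕ → Submodule R M
  | 0 => ⊥
  | 1 => L1
  | (n + 2) => Submodule.span R
      {z | ∃ x ∈ gradedPieces L1 (n + 1), ∃ y ∈ L1, z = ⁅x, y⁆}

/-- Iterated bracketing with `L1`, starting from `X0`:
`bracketIter R L1 X0 (j+1) = [bracketIter R L1 X0 j, L1]`. -/
def bracketIter (L1 X0 : Submodule R M) : ℕ → Submodule R M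
  | 0 => X0
  | (j + 1) => Submodule.span R
      {z | ∃ x ∈ bracketIter L1 X0 j, ∃ y ∈ L1, z = ⁅x, y⁆}

/-- `gr` is the grading of a graded Lie algebra `⊕_{i ≥ 1} gr i`, generated by its
first homogeneous component. -/
structure IsGradedLie (gr : ℕ → Submodule R M) : Prop where
  bot : gr 0 = ⊥
  internal : DirectSum.IsInternal gr
  bracket_mem : ∀ i j, ∀ x ∈ gr i, ∀ y ∈ gr j, ⁅x, y⁆ ∈ gr (i + j)
  gen : ∀ i, 1 ≤ i → gr (i + 1) =
    Submodule.span R {z | ∃ x ∈ gr i, ∃ y ∈ gr 1, z = ⁅x, y⁆}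

/-- `J` is a graded ideal of the graded Lie algebra with grading `gr`, presented via its
homogeneous components `J i = J ∩ gr i`. -/
def IsGradedIdealFam (gr J : ℕ → Submodule R M) : Prop :=
  (∀ i, J i ≤ gr i) ∧ ∀ i j, ∀ z ∈ J i, ∀ x ∈ gr j, ⁅z, x⁆ ∈ J (i + j)

/-- The graded Lie algebra with grading `gr` is ideally `r`-constrained: every nonzero
graded ideal `J` satisfies `L^i ⊇ J ⊇ L^(i+r)` for some `i`. -/
def IdeallyConstrained (gr : ℕ → Submodule R M) (r : ℕ) : Prop :=
  ∀ J : ℕ → Submodule R M, IsGradedIdealFam R gr J → (∃ i, J i ≠ ⊥) →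
    ∃ i, (∀ j, j < i → J j = ⊥) ∧ ∀ j, i + r ≤ j → J j = gr j

/-- The graded Lie algebra with grading `gr` is just infinite: every nonzero graded ideal
has finite codimension. -/
def JustInfinite (gr : ℕ → Submodule R M) : Prop :=
  ∀ J : ℕ → Submodule R M, IsGradedIdealFam R gr J → (∃ i, J i ≠ ⊥) →
    FiniteDimensional R (↥(⨆ i, gr i) ⧸ ((⨆ i, J i).comap (⨆ i, gr i).subtype))

end Defs

section MaxClass

variable (E : Type*) [Field E] {M : Type*} [LieRing M] [LieAlgebra E M]

/-- `gr` is the grading of a Lie algebra of maximal class over `E`. -/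
structure IsMaxClass (gr : ℕ → Submodule E M) : Prop where
  graded : IsGradedLie E gr
  dim_one : Module.finrank E ↥(gr 1) = 2
  dim_ge_two : ∀ i, 2 ≤ i → Module.finrank E ↥(gr i) = 1

/-- The `i`-th two-step centraliser `C_i = C_{M_1}(M_i)`. -/
def twoStepCent (gr : ℕ → Submodule E M) (i : ℕ) : Submodule E M :=
  gr 1 ⊓ ⨅ m : ↥(gr i), LinearMap.ker (LieAlgebra.ad E M (m : M))

end MaxClass

/-- The set `E_s` of scalars stabilising a subset `s` of an `E`-vector space. -/
def scalarStab (E : Type*) [Field E] {M : Type*} [AddCommGroup M] [Module E M]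
    (s : Set M) : Set E := {α | ∀ v ∈ s, α • v ∈ s}

section RestrictedScalars

variable {F E M : Type*} [Field F] [Field E] [Algebra F E] [LieRing M] [LieAlgebra E M]
  [Module F M] [IsScalarTower F E M]

theorem smul_lie_of_isScalarTower (E : Type*) {F M : Type*} [Field F] [Field E] [Algebra F E]
    [LieRing M] [LieAlgebra E M] [Module F M] [IsScalarTower F E M] (a : F) (x y : M) :
    ⁅a • x, y⁆ = a • ⁅x, y⁆ := by
  rw [← algebraMap_smul E a x, smul_lie, algebraMap_smul]

theorem lie_mem_gradedPieces_succ (L₁ : Submodule F M) {i : ℕ} {x y : M}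
    (hx : x ∈ gradedPieces F L₁ i) (hy : y ∈ L₁) : ⁅x, y⁆ ∈ gradedPieces F L₁ (i + 1) := by
  cases i with
  | zero =>
    have hx0 : x = 0 := by simpa [gradedPieces] using hx
    simp [hx0]
  | succ n => exact Submodule.subset_span ⟨x, hx, y, hy, rfl⟩

theorem bracketIter_le_gradedPieces (L₁ X₀ : Submodule F M) {i : ℕ}
    (hX₀ : X₀ ≤ gradedPieces F L₁ i) (k : ℕ) :
    bracketIter F L₁ X₀ k ≤ gradedPieces F L₁ (i + k) := by
  induction k with
  | zero => exact hX₀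
  | succ k ih =>
    refine Submodule.span_le.2 ?_
    rintro _ ⟨x, hx, y, hy, rfl⟩
    exact lie_mem_gradedPieces_succ L₁ (ih hx) hy

theorem lie_mem_bracketIter (E : Type*) {F M : Type*} [Field F] [Field E] [Algebra F E]
    [LieRing M] [LieAlgebra E M] [Module F M] [IsScalarTower F E M] (L₁ X₀ : Submodule F M) (j : ℕ) :
    ∀ k, ∀ z ∈ bracketIter F L₁ X₀ k, ∀ x ∈ gradedPieces F L₁ j,
      ⁅z, x⁆ ∈ bracketIter F L₁ X₀ (k + j) := by
  induction j with
  | zero =>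
    intro k z _ x hx
    have hx0 : x = 0 := by simpa [gradedPieces] using hx
    simp [hx0]
  | succ j ih =>
    intro k z hz x hx
    cases j with
    | zero => exact Submodule.subset_span ⟨z, hz, x, hx, rfl⟩
    | succ n =>
      let f : M →ₗ[F] M := (LieAlgebra.ad E M z).restrictScalars F
      suffices h : gradedPieces F L₁ (n + 2) ≤ (bracketIter F L₁ X₀ (k + (n + 2))).comap f from
        h hx
      refine Submodule.span_le.2 ?_
      rintro _ ⟨u, hu, y, hy, rfl⟩
      change ⁅z, ⁅u, y⁆⁆ ∈ bracketIter F L₁ X₀ (k + (n + 2))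
      have hzy : ⁅z, y⁆ ∈ bracketIter F L₁ X₀ (k + 1) := Submodule.subset_span ⟨z, hz, y, hy, rfl⟩
      have h₁ : ⁅⁅z, u⁆, y⁆ ∈ bracketIter F L₁ X₀ (k + (n + 1) + 1) :=
        Submodule.subset_span ⟨_, ih k z hz u hu, y, hy, rfl⟩
      have h₂ := ih (k + 1) _ hzy u hu
      rw [show k + 1 + (n + 1) = k + (n + 2) by omega] at h₂
      have h₃ : ⁅z, ⁅u, y⁆⁆ = ⁅⁅z, u⁆, y⁆ - ⁅⁅z, y⁆, u⁆ := by
        rw [leibniz_lie z u y, ← lie_skew u ⁅z, y⁆, sub_eq_add_neg]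
      rw [h₃]
      exact Submodule.sub_mem _ h₁ h₂

variable (E) in
/-- In an ideally `1`-constrained algebra, bracketing any nonzero homogeneous element with the
first component yields the whole next component. -/
theorem IdeallyConstrained.gradedPieces_succ_eq_map_ad {L₁ : Submodule F M}
    (hc : IdeallyConstrained F (gradedPieces F L₁) 1) {i : ℕ} {z : M}
    (hz : z ∈ gradedPieces F L₁ i) (hz0 : z ≠ 0) :
    gradedPieces F L₁ (i + 1) = L₁.map ((LieAlgebra.ad E M z).restrictScalars F) := by
  let B := bracketIter F L₁ (Submodule.span F {z})
  have hB : ∀ k, B k ≤ gradedPieces F L₁ (i + k) :=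
    bracketIter_le_gradedPieces L₁ _ ((Submodule.span_singleton_le_iff_mem _ _).2 hz)
  let J : ℕ → Submodule F M := fun n => if n < i then ⊥ else B (n - i)
  have hJlt : ∀ n, n < i → J n = ⊥ := fun n hn => if_pos hn
  have hJadd : ∀ k, J (i + k) = B k := fun k => by simp [J]
  have hJ : IsGradedIdealFam F (gradedPieces F L₁) J := by
    refine ⟨fun n => ?_, fun n j u hu x hx => ?_⟩
    · rcases lt_or_ge n i with hn | hn
      · simp [hJlt n hn]
      · obtain ⟨k, rfl⟩ := Nat.exists_eq_add_of_le hn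
        rw [hJadd]
        exact hB k
    · rcases lt_or_ge n i with hn | hn
      · have hu0 : u = 0 := by simpa [hJlt n hn] using hu
        simp [hu0]
      · obtain ⟨k, rfl⟩ := Nat.exists_eq_add_of_le hn
        rw [hJadd] at hu
        rw [add_assoc, hJadd]
        exact lie_mem_bracketIter E L₁ _ j k u hu x hx
  have hzJ : z ∈ J i := by
    have : z ∈ B 0 := Submodule.mem_span_singleton_self z
    rwa [← hJadd] at this
  have hJi : J i ≠ ⊥ := fun h => hz0 (by simpa [h] using hzJ)
  obtain ⟨i₀, hbot, htop⟩ := hc J hJ ⟨i, hJi⟩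
  have hi₀ : i₀ ≤ i := not_lt.1 fun h => hJi (hbot i h)
  rw [← htop (i + 1) (by omega), hJadd]
  refine le_antisymm (Submodule.span_le.2 ?_) ?_
  · rintro _ ⟨x, hx, y, hy, rfl⟩
    obtain ⟨a, rfl⟩ := Submodule.mem_span_singleton.1 hx
    rw [smul_lie_of_isScalarTower E]
    exact Submodule.smul_mem _ a ⟨y, hy, rfl⟩
  · rintro _ ⟨y, hy, rfl⟩
    exact Submodule.subset_span ⟨z, Submodule.mem_span_singleton_self z, y, hy, rfl⟩

end RestrictedScalars

section MaximalClass

variable {E M : Type*} [Field E] [LieRing M] [LieAlgebra E M] {Mgr : ℕ → Submodule E M}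

theorem mem_twoStepCent {i : ℕ} {v : M} :
    v ∈ twoStepCent E Mgr i ↔ v ∈ Mgr 1 ∧ ∀ m ∈ Mgr i, ⁅m, v⁆ = 0 := by
  simp [twoStepCent]

namespace IsMaxClass

theorem exists_smul_eq (hM : IsMaxClass E Mgr) {i : ℕ} (hi : 2 ≤ i) {e m : M}
    (he : e ∈ Mgr i) (he0 : e ≠ 0) (hm : m ∈ Mgr i) : ∃ a : E, a • e = m := by
  obtain ⟨a, ha⟩ := (finrank_eq_one_iff_of_nonzero' (⟨e, he⟩ : Mgr i)
    (by simpa using he0)).1 (hM.dim_ge_two i hi) ⟨m, hm⟩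
  exact ⟨a, congrArg Subtype.val ha⟩

theorem exists_mem_ne_zero (hM : IsMaxClass E Mgr) {i : ℕ} (hi : 2 ≤ i) :
    ∃ e ∈ Mgr i, e ≠ 0 := by
  refine (Submodule.ne_bot_iff _).1 fun h => ?_
  have := hM.dim_ge_two i hi
  rw [h, finrank_bot] at this
  exact zero_ne_one this

theorem mem_twoStepCent_iff (hM : IsMaxClass E Mgr) {i : ℕ} (hi : 2 ≤ i) {e v : M}
    (he : e ∈ Mgr i) (he0 : e ≠ 0) (hv : v ∈ Mgr 1) :
    v ∈ twoStepCent E Mgr i ↔ ⁅e, v⁆ = 0 := by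
  refine mem_twoStepCent.trans ⟨fun h => h.2 e he, fun h => ⟨hv, fun m hm => ?_⟩⟩
  obtain ⟨a, rfl⟩ := hM.exists_smul_eq hi he he0 hm
  rw [smul_lie, h, smul_zero]

theorem not_le_twoStepCent (hM : IsMaxClass E Mgr) {i : ℕ} (hi : 2 ≤ i) :
    ¬ Mgr 1 ≤ twoStepCent E Mgr i := by
  intro h
  obtain ⟨e, he, he0⟩ := hM.exists_mem_ne_zero (i := i + 1) (by omega)
  rw [hM.graded.gen i (by omega)] at he
  refine he0 ((Submodule.mem_bot E).1 (Submodule.span_le.2 ?_ he))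
  rintro _ ⟨x, hx, y, hy, rfl⟩
  exact (mem_twoStepCent.1 (h hy)).2 x hx

/-- A functional on the first component describing its action on a component of degree at
least `2`, normalised to take the value `1` somewhere on a prescribed spanning set. -/
theorem exists_functional (hM : IsMaxClass E Mgr) {s : Set M}
    (hspan : Submodule.span E s = Mgr 1) {i : ℕ} (hi : 2 ≤ i) :
    ∃ φ : M →ₗ[E] E, (∀ v ∈ Mgr 1, (φ v = 0 ↔ v ∈ twoStepCent E Mgr i)) ∧
      (1 : E) ∈ φ '' s ∧
      ∀ m ∈ Mgr i, m ≠ 0 → ∃ c : M, c ≠ 0 ∧ ∀ v ∈ Mgr 1, ⁅m, v⁆ = φ v • c := by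
  obtain ⟨e, he, he0⟩ := hM.exists_mem_ne_zero hi
  have hs : ∀ {x}, x ∈ s → x ∈ Mgr 1 := fun {x} hx => hspan ▸ Submodule.subset_span hx
  obtain ⟨x, hx, hex⟩ : ∃ x ∈ s, ⁅e, x⁆ ≠ 0 := by
    by_contra! h
    refine hM.not_le_twoStepCent hi ?_
    rw [← hspan]
    exact Submodule.span_le.2 fun x hx => (hM.mem_twoStepCent_iff hi he he0 (hs hx)).2 (h x hx)
  have hw : ⁅e, x⁆ ∈ Mgr (i + 1) := hM.graded.bracket_mem i 1 e he x (hs hx)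
  obtain ⟨ψ, hψ⟩ := (LinearMap.toSpanSingleton E M ⁅e, x⁆).exists_leftInverse_of_injective
    (LinearMap.ker_toSpanSingleton E hex)
  have hψ1 : ψ ⁅e, x⁆ = 1 := by simpa using LinearMap.congr_fun hψ 1
  have key : ∀ v ∈ Mgr 1, ⁅e, v⁆ = ψ ⁅e, v⁆ • ⁅e, x⁆ := by
    intro v hv
    obtain ⟨a, ha⟩ := hM.exists_smul_eq (by omega) hw hex (hM.graded.bracket_mem i 1 e he v hv)
    rw [← ha, map_smul, hψ1, smul_eq_mul, mul_one]
  refine ⟨ψ ∘ₗ (LieAlgebra.ad E M e : M →ₗ[E] M), fun v hv => ?_, ⟨x, hx, hψ1⟩, fun m hm hm0 => ?_⟩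
  · rw [hM.mem_twoStepCent_iff hi he he0 hv]
    change ψ ⁅e, v⁆ = 0 ↔ _
    refine ⟨fun h => ?_, fun h => by rw [h, map_zero]⟩
    rw [key v hv, h, zero_smul]
  · obtain ⟨a, rfl⟩ := hM.exists_smul_eq hi he he0 hm
    refine ⟨a • ⁅e, x⁆, smul_ne_zero (fun h => hm0 (by rw [h, zero_smul])) hex, fun v hv => ?_⟩
    rw [smul_lie, key v hv, smul_comm]
    rfl

/-- Two-step centralisers sharing a nonzero element coincide. -/
theorem twoStepCent_eq_of_mem (hM : IsMaxClass E Mgr) {i j : ℕ} (hi : 2 ≤ i) (hj : 2 ≤ j)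
    {y : M} (hy0 : y ≠ 0) (hyi : y ∈ twoStepCent E Mgr i) (hyj : y ∈ twoStepCent E Mgr j) :
    twoStepCent E Mgr i = twoStepCent E Mgr j := by
  have hfin : FiniteDimensional E (Mgr 1) :=
    Module.finite_of_finrank_pos (by rw [hM.dim_one]; norm_num)
  have aux : ∀ k, 2 ≤ k → y ∈ twoStepCent E Mgr k →
      twoStepCent E Mgr k = Submodule.span E {y} := by
    intro k hk hyk
    have hle : twoStepCent E Mgr k ≤ Mgr 1 := inf_le_left
    have hlt := Submodule.finrank_lt_finrank_of_lt
      (lt_of_le_not_ge hle (hM.not_le_twoStepCent hk))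
    rw [hM.dim_one] at hlt
    have hfink : FiniteDimensional E (twoStepCent E Mgr k) :=
      Submodule.finiteDimensional_of_le hle
    refine (Submodule.eq_of_le_of_finrank_le
      ((Submodule.span_singleton_le_iff_mem _ _).2 hyk) ?_).symm
    rw [finrank_span_singleton hy0]
    omega
  rw [aux i hi hyi, aux j hj hyj]

theorem exists_mem_twoStepCent_ne_zero (hM : IsMaxClass E Mgr) {i : ℕ} (hi : 2 ≤ i) :
    ∃ y ∈ twoStepCent E Mgr i, y ≠ 0 := by
  obtain ⟨φ, hφ, -, -⟩ := hM.exists_functional (s := Mgr 1) (Submodule.span_eq _) hi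
  have hfin : FiniteDimensional E (Mgr 1) :=
    Module.finite_of_finrank_pos (by rw [hM.dim_one]; norm_num)
  have hker : LinearMap.ker (φ ∘ₗ (Mgr 1).subtype) ≠ ⊥ :=
    LinearMap.ker_ne_bot_of_finrank_lt (by rw [hM.dim_one, Module.finrank_self]; norm_num)
  obtain ⟨y, hy, hy0⟩ := (Submodule.ne_bot_iff _).1 hker
  exact ⟨y, (hφ y y.2).1 hy, by simpa using hy0⟩

theorem lie_mem_ne_zero (hM : IsMaxClass E Mgr) {i : ℕ} (hi : 2 ≤ i) {e v : M}
    (he : e ∈ Mgr i) (he0 : e ≠ 0) (hv : v ∈ Mgr 1) (hvi : v ∉ twoStepCent E Mgr i) :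
    ⁅e, v⁆ ∈ Mgr (i + 1) ∧ ⁅e, v⁆ ≠ 0 :=
  ⟨hM.graded.bracket_mem i 1 e he v hv, fun h => hvi ((hM.mem_twoStepCent_iff hi he he0 hv).2 h)⟩

/-- Two-step centralisers different from the first one are isolated. -/
theorem mem_twoStepCent_or_succ (hM : IsMaxClass E Mgr) {y : M}
    (hy : y ∈ twoStepCent E Mgr 2) {j : ℕ} (hj : 2 ≤ j) :
    y ∈ twoStepCent E Mgr j ∨ y ∈ twoStepCent E Mgr (j + 1) := by
  induction j, hj using Nat.le_induction with
  | base => exact Or.inl hy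
  | succ j hj ih =>
    by_contra! h
    have hyj : y ∈ twoStepCent E Mgr j := ih.resolve_right h.1
    have hy1 : y ∈ Mgr 1 := (mem_twoStepCent.1 hy).1
    obtain ⟨x, hx, hxj⟩ := SetLike.not_le_iff_exists.1 (hM.not_le_twoStepCent hj)
    obtain ⟨e, he, he0⟩ := hM.exists_mem_ne_zero hj
    have h₁ := hM.lie_mem_ne_zero hj he he0 hx hxj
    have h₂ := hM.lie_mem_ne_zero (by omega) h₁.1 h₁.2 hy1 h.1
    have h₃ := hM.lie_mem_ne_zero (by omega) h₂.1 h₂.2 hy1 h.2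
    have hey : ⁅e, y⁆ = 0 := (mem_twoStepCent.1 hyj).2 e he
    have hxyy : ⁅⁅x, y⁆, y⁆ = 0 :=
      (mem_twoStepCent.1 hy).2 _ (hM.graded.bracket_mem 1 1 x hx y hy1)
    refine h₃.2 ?_
    have h₄ : ⁅⁅e, x⁆, y⁆ = ⁅e, ⁅x, y⁆⁆ := by
      rw [leibniz_lie e x y, hey, lie_zero, add_zero]
    have h₅ := leibniz_lie e ⁅x, y⁆ y
    rw [hxyy, hey, lie_zero, lie_zero, add_zero] at h₅
    rw [h₄, ← h₅]

end IsMaxClass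

end MaximalClass

section Components

variable {F E M : Type*} [Field F] [Field E] [Algebra F E] [LieRing M] [LieAlgebra E M]
  [Module F M] [IsScalarTower F E M] {Mgr : ℕ → Submodule E M} {L₁ : Submodule F M}

theorem IsMaxClass.gradedPieces_subset (hM : IsMaxClass E Mgr)
    (hL₁ : (L₁ : Set M) ⊆ (Mgr 1 : Set M)) (i : ℕ) :
    (gradedPieces F L₁ i : Set M) ⊆ Mgr i := by
  induction i with
  | zero =>
    intro x hx
    have hx0 : x = 0 := by simpa [gradedPieces] using hx
    simp [hx0]
  | succ n ih =>
    cases n with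
    | zero => exact hL₁
    | succ n =>
      change gradedPieces F L₁ (n + 2) ≤ (Mgr (n + 2)).restrictScalars F
      refine Submodule.span_le.2 ?_
      rintro _ ⟨x, hx, y, hy, rfl⟩
      exact hM.graded.bracket_mem (n + 1) 1 x (ih hx) y (hL₁ hy)

theorem IsMaxClass.exists_mem_gradedPieces_ne_zero (hM : IsMaxClass E Mgr)
    (hL₁ : (L₁ : Set M) ⊆ (Mgr 1 : Set M))
    (hspan : Submodule.span E (L₁ : Set M) = Mgr 1) {i : ℕ} (hi : 2 ≤ i) :
    ∃ z ∈ gradedPieces F L₁ i, z ≠ 0 := by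
  induction i, hi using Nat.le_induction with
  | base =>
    by_contra! h
    obtain ⟨e, he, he0⟩ := hM.exists_mem_ne_zero le_rfl
    have hcomm : ∀ x ∈ L₁, ∀ y ∈ L₁, ⁅x, y⁆ = 0 := fun x hx y hy =>
      h _ (lie_mem_gradedPieces_succ L₁ (i := 1) hx hy)
    have hL : ∀ x ∈ L₁, ∀ y ∈ Mgr 1, ⁅x, y⁆ = 0 := by
      intro x hx
      suffices h : Mgr 1 ≤ LinearMap.ker (LieAlgebra.ad E M x : M →ₗ[E] M) from
        fun y hy => h hy
      rw [← hspan]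
      exact Submodule.span_le.2 fun y hy => hcomm x hx y hy
    have hMc : ∀ x ∈ Mgr 1, ∀ y ∈ Mgr 1, ⁅x, y⁆ = 0 := by
      intro x hx y hy
      suffices h : Mgr 1 ≤ LinearMap.ker (LieAlgebra.ad E M y : M →ₗ[E] M) by
        rw [← lie_skew, show ⁅y, x⁆ = 0 from h hx, neg_zero]
      rw [← hspan]
      refine Submodule.span_le.2 fun z hz => ?_
      change ⁅y, z⁆ = 0
      rw [← lie_skew, hL z hz y hy, neg_zero]
    rw [hM.graded.gen 1 le_rfl] at he
    refine he0 ((Submodule.mem_bot E).1 (Submodule.span_le.2 ?_ he))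
    rintro _ ⟨x, hx, y, hy, rfl⟩
    exact hMc x hx y hy
  | succ i hi ih =>
    obtain ⟨z, hz, hz0⟩ := ih
    obtain ⟨φ, -, ⟨x, hx, hφx⟩, hφ⟩ := hM.exists_functional hspan hi
    obtain ⟨c, hc0, hc⟩ := hφ z (hM.gradedPieces_subset hL₁ i hz) hz0
    refine ⟨_, lie_mem_gradedPieces_succ L₁ hz hx, ?_⟩
    rw [hc x (hL₁ hx), hφx, one_smul]
    exact hc0

/-- If the elements of `V` are algebraic and stabilise `W`, and `W` contains `1`, then `W` contains
the field generated by `V`. -/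
theorem adjoin_subset_of_mul_mem {V W : Submodule F E}
    (hV : ∀ v ∈ V, IsAlgebraic F v) (h1 : (1 : E) ∈ W)
    (h : ∀ v ∈ V, ∀ w ∈ W, v * w ∈ W) :
    (IntermediateField.adjoin F (V : Set E) : Set E) ⊆ W := by
  intro a ha
  have ha' : a ∈ Algebra.adjoin F (V : Set E) := by
    rwa [← IntermediateField.adjoin_toSubalgebra_of_isAlgebraic hV]
  suffices hs : ∀ w ∈ W, a * w ∈ W by simpa using hs 1 h1
  clear ha
  induction ha' using Algebra.adjoin_induction with
  | mem v hv => exact h v hv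
  | algebraMap r =>
    intro w hw
    rw [← Algebra.smul_def]
    exact W.smul_mem r hw
  | add a b _ _ iha ihb =>
    intro w hw
    rw [add_mul]
    exact W.add_mem (iha w hw) (ihb w hw)
  | mul a b _ _ iha ihb =>
    intro w hw
    rw [mul_assoc]
    exact iha _ (ihb w hw)

end Components

theorem ideally_constrained_dims (F E : Type*) [Field F] [Field E] [Algebra F E]
    (M : Type*) [LieRing M] [LieAlgebra E M] [Module F M] [IsScalarTower F E M]
    (Mgr : ℕ → Submodule E M) (hM : IsMaxClass E Mgr)
    (L₁ : Submodule F M) (hL₁fin : FiniteDimensional F ↥L₁)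
    (hL₁ : (L₁ : Set M) ⊆ (Mgr 1 : Set M))
    (hspan : Submodule.span E (L₁ : Set M) = Mgr 1)
    (Ffield : ℕ → IntermediateField F E)
    (hFf : ∀ i, 2 ≤ i → ∀ φ : M →ₗ[E] E,
      (∀ v ∈ Mgr 1, (φ v = 0 ↔ v ∈ twoStepCent E Mgr i)) →
      (1 : E) ∈ ⇑φ '' (L₁ : Set M) →
      Ffield i = IntermediateField.adjoin F (⇑φ '' (L₁ : Set M)))
    (K : IntermediateField F E)
    (hK : K = ⨆ i : {n : ℕ // 2 ≤ n}, Ffield i)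
    (hKfin : FiniteDimensional F ↥K)
    (hc : IdeallyConstrained F (gradedPieces F L₁) 1) :
    (∀ i, 3 ≤ i → Module.finrank F ↥(gradedPieces F L₁ i) = Module.finrank F ↥K) ∧
    (∀ i, 2 ≤ i → Ffield i = K) := by
  choose! φ hker hone hact using fun (i : ℕ) (hi : 2 ≤ i) => hM.exists_functional hspan hi
  let V : ℕ → Submodule F E := fun i => L₁.map ((φ i).restrictScalars F)
  have hFV : ∀ i, 2 ≤ i → Ffield i = IntermediateField.adjoin F (V i : Set E) :=
    fun i hi => hFf i hi (φ i) (hker i hi) (hone i hi)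
  have hV1 : ∀ i, 2 ≤ i → (1 : E) ∈ V i := hone
  have hVF : ∀ i, 2 ≤ i → ∀ v ∈ V i, v ∈ Ffield i := fun i hi v hv => by
    rw [hFV i hi]
    exact IntermediateField.subset_adjoin F _ hv
  have hFK : ∀ i, 2 ≤ i → Ffield i ≤ K := fun i hi => by
    rw [hK]
    exact le_iSup (fun i : {n : ℕ // 2 ≤ n} => Ffield i) ⟨i, hi⟩
  have hpieces : ∀ i, 2 ≤ i → ∃ w : M, w ≠ 0 ∧ gradedPieces F L₁ (i + 1) =
      (V i).map ((LinearMap.toSpanSingleton E M w).restrictScalars F) := by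
    intro i hi
    obtain ⟨z, hz, hz0⟩ := hM.exists_mem_gradedPieces_ne_zero hL₁ hspan hi
    obtain ⟨w, hw0, hw⟩ := hact i hi z (hM.gradedPieces_subset hL₁ i hz) hz0
    refine ⟨w, hw0, ?_⟩
    rw [hc.gradedPieces_succ_eq_map_ad E hz hz0, ← Submodule.map_comp]
    exact SetLike.coe_injective (Set.image_congr fun v hv => hw v (hL₁ hv))
  have hfinrank : ∀ i, 2 ≤ i →
      Module.finrank F (gradedPieces F L₁ (i + 1)) = Module.finrank F (V i) := by
    intro i hi
    obtain ⟨w, hw0, hw⟩ := hpieces i hi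
    rw [hw]
    exact (Submodule.equivMapOfInjective _ (smul_left_injective E hw0) (V i)).finrank_eq.symm
  have hmul : ∀ i, 2 ≤ i → ∀ a ∈ V i, ∀ b ∈ V (i + 1), a * b ∈ V (i + 1) := by
    intro i hi a ha b hb
    rcases eq_or_ne a 0 with rfl | ha0
    · simp
    obtain ⟨w, hw0, hw⟩ := hpieces i hi
    have hmem : ∀ a ∈ V i, a • w ∈ gradedPieces F L₁ (i + 1) := fun a ha => by
      rw [hw]
      exact ⟨a, ha, rfl⟩
    have hw' : w ∈ gradedPieces F L₁ (i + 1) := by simpa using hmem 1 (hV1 i hi)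
    obtain ⟨c, hc0, hwc⟩ := hact (i + 1) (by omega) w (hM.gradedPieces_subset hL₁ _ hw') hw0
    obtain ⟨v, hv, rfl⟩ := hb
    have hbr : ⁅a • w, v⁆ ∈ gradedPieces F L₁ (i + 1 + 1) :=
      lie_mem_gradedPieces_succ L₁ (hmem a ha) hv
    rw [hc.gradedPieces_succ_eq_map_ad E hw' hw0] at hbr
    obtain ⟨u, hu, huv⟩ := hbr
    refine ⟨u, hu, ?_⟩
    change ⁅w, u⁆ = ⁅a • w, v⁆ at huv
    rw [smul_lie, hwc u (hL₁ hu), hwc v (hL₁ hv), smul_smul] at huv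
    exact smul_left_injective E hc0 huv
  have hFsub : ∀ i, 2 ≤ i → (Ffield i : Set E) ⊆ V (i + 1) := by
    intro i hi
    rw [hFV i hi]
    refine adjoin_subset_of_mul_mem (fun v hv => ?_) (hV1 _ (by omega)) (hmul i hi)
    exact IntermediateField.isAlgebraic_iff.1 (Algebra.IsAlgebraic.isAlgebraic (⟨v, hFK i hi (hVF i hi v hv)⟩ : K))
  have hmono : ∀ i, 2 ≤ i → ∀ j, i ≤ j → Ffield i ≤ Ffield j := by
    intro i hi j hij
    induction j, hij using Nat.le_induction with
    | base => exact le_rfl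
    | succ j hij ih => exact ih.trans fun a ha => hVF _ (by omega) a (hFsub j (by omega) ha)
  obtain ⟨y, hy, hy0⟩ := hM.exists_mem_twoStepCent_ne_zero le_rfl
  have hrec : ∀ i, 2 ≤ i → ∃ j, i < j ∧ twoStepCent E Mgr j = twoStepCent E Mgr 2 := by
    intro i hi
    rcases hM.mem_twoStepCent_or_succ hy (j := i + 1) (by omega) with h | h
    · exact ⟨i + 1, by omega, hM.twoStepCent_eq_of_mem (by omega) le_rfl hy0 h hy⟩
    · exact ⟨i + 1 + 1, by omega, hM.twoStepCent_eq_of_mem (by omega) le_rfl hy0 h hy⟩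
  have hF2 : ∀ i, 2 ≤ i → Ffield i = Ffield 2 := by
    intro i hi
    obtain ⟨j, hij, hj⟩ := hrec i hi
    refine le_antisymm ((hmono i hi j hij.le).trans_eq ?_) (hmono 2 le_rfl i hi)
    rw [hFV 2 le_rfl]
    exact hFf j (by omega) (φ 2) (by rw [hj]; exact hker 2 le_rfl) (hone 2 le_rfl)
  have hFeq : ∀ i, 2 ≤ i → Ffield i = K := by
    intro i hi
    refine le_antisymm (hFK i hi) ?_
    rw [hK, hF2 i hi]
    exact iSup_le fun j => (hF2 j j.2).le
  have hVK : ∀ i, 3 ≤ i → V i = Subalgebra.toSubmodule K.toSubalgebra := by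
    intro i hi
    obtain ⟨k, rfl⟩ := Nat.exists_eq_add_of_le' hi
    refine SetLike.coe_injective (Set.Subset.antisymm (fun v hv => ?_) fun v hv => ?_)
    · exact hFK _ (by omega) (hVF _ (by omega) v hv)
    · refine hFsub (k + 2) (by omega) ?_
      rw [hFeq _ (by omega)]
      exact hv
  have hV2 : ∃ j, 3 ≤ j ∧ Module.finrank F (V 2) = Module.finrank F (V j) := by
    obtain ⟨j, hj2, hj⟩ := hrec 2 le_rfl
    refine ⟨j, hj2, ?_⟩
    obtain ⟨x, hx, hφx⟩ := hone 2 le_rfl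
    have hφ : ∀ v ∈ Mgr 1, φ j x * φ 2 v = φ j v := by
      intro v hv
      have hmem : v - φ 2 v • x ∈ Mgr 1 := sub_mem hv (Submodule.smul_mem _ _ (hL₁ hx))
      have h := (hker j (by omega) _ hmem).2 (by
        rw [hj, ← hker 2 le_rfl _ hmem, map_sub, map_smul, hφx, smul_eq_mul, mul_one, sub_self])
      rw [map_sub, map_smul, smul_eq_mul, sub_eq_zero] at h
      rw [h, mul_comm]
    have hne : φ j x ≠ 0 := fun h => by
      have := (hker 2 le_rfl x (hL₁ hx)).2 (hj ▸ (hker j (by omega) x (hL₁ hx)).1 h)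
      exact one_ne_zero (hφx.symm.trans this)
    have hVj : V j = (V 2).map (LinearMap.mulLeft F (φ j x)) := by
      rw [← Submodule.map_comp]
      exact SetLike.coe_injective (Set.image_congr fun v hv => (hφ v (hL₁ hv)).symm)
    rw [hVj]
    exact (Submodule.equivMapOfInjective _ (mul_right_injective₀ hne) (V 2)).finrank_eq
  refine ⟨fun i hi => ?_, hFeq⟩
  obtain ⟨k, rfl⟩ := Nat.exists_eq_add_of_le' hi
  rw [hfinrank (k + 2) (by omega)]
  cases k with
  | zero =>
    obtain ⟨j, hj, hVj⟩ := hV2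
    rw [hVj, hVK j hj]
    rfl
  | succ k =>
    rw [hVK _ (by omega)]
    rfl
end

section
/- Let E ⊇ F be fields, V an E-vector space, C an E-subspace of V of codimension 1, and W an F-subspace of V with W ⊄ C, and let φ: V → E be E-linear with ker φ = C and 1 ∈ φ(W). Then: (1) F⟨W,C⟩ = F if and only if dim_F(W/(W ∩ C)) = 1; (2) [F⟨W,C⟩ : F] ≥ dim_F(W/(W ∩ C)); (3) if dim_F(W/(W ∩ C)) is finite, then equality holds in (2) if and only if φ(W) is a subfield of E. -/
set_option synthInstance.maxHeartbeats 1000000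
set_option maxHeartbeats 1000000

universe u v w

section SubmoduleAdjoin

variable {F E : Type*} [Field F] [Field E] [Algebra F E]

theorem Submodule.le_toSubmodule_adjoin (U : Submodule F E) :
    U ≤ Subalgebra.toSubmodule (IntermediateField.adjoin F (U : Set E)).toSubalgebra :=
  IntermediateField.subset_adjoin F (U : Set E)

theorem Submodule.rank_le_rank_adjoin (U : Submodule F E) :
    Module.rank F U ≤ Module.rank F (IntermediateField.adjoin F (U : Set E)) :=
  Submodule.rank_mono U.le_toSubmodule_adjoin

theorem Submodule.adjoin_eq_bot_iff_rank_eq_one {U : Submodule F E} (h1 : (1 : E) ∈ U) :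
    IntermediateField.adjoin F (U : Set E) = ⊥ ↔ Module.rank F U = 1 := by
  constructor
  · intro h
    refine le_antisymm ?_ ?_
    · have hle := U.rank_le_rank_adjoin
      rwa [h, IntermediateField.rank_bot] at hle
    · rw [Cardinal.one_le_iff_ne_zero, ne_eq, Submodule.rank_eq_zero]
      rintro rfl
      exact one_ne_zero ((Submodule.mem_bot F).mp h1)
  · intro h
    obtain ⟨v, -, hv⟩ := (rank_submodule_eq_one_iff U).mp h
    obtain ⟨a, ha⟩ := Submodule.mem_span_singleton.mp (hv.2 h1)
    have ha0 : a ≠ 0 := by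
      rintro rfl
      simp at ha
    have hv1 : v = algebraMap F E a⁻¹ := by
      rw [Algebra.algebraMap_eq_smul_one, ← ha, inv_smul_smul₀ ha0]
    rw [IntermediateField.adjoin_eq_bot_iff]
    intro x hx
    obtain ⟨b, rfl⟩ := Submodule.mem_span_singleton.mp (hv.2 hx)
    rw [hv1]
    exact (⊥ : IntermediateField F E).smul_mem (IntermediateField.algebraMap_mem _ _)

theorem Submodule.rank_adjoin_eq_iff_exists_subfield {U : Submodule F E} (h1 : (1 : E) ∈ U)
    (hU : Module.rank F U < Cardinal.aleph0) :
    Module.rank F (IntermediateField.adjoin F (U : Set E)) = Module.rank F U ↔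
      ∃ S : Subfield E, (S : Set E) = U := by
  constructor
  · intro h
    have : FiniteDimensional F (Subalgebra.toSubmodule
        (IntermediateField.adjoin F (U : Set E)).toSubalgebra) :=
      Module.rank_lt_aleph0_iff.mp (h.trans_lt hU)
    have hEq := Submodule.eq_of_le_of_finrank_eq U.le_toSubmodule_adjoin
      (congrArg Cardinal.toNat h.symm)
    exact ⟨(IntermediateField.adjoin F (U : Set E)).toSubfield,
      (congrArg (fun X : Submodule F E => (X : Set E)) hEq).symm⟩
  · rintro ⟨S, hS⟩
    have hmem : ∀ x, algebraMap F E x ∈ S := fun x => by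
      rw [← SetLike.mem_coe, hS, Algebra.algebraMap_eq_smul_one]
      exact U.smul_mem x h1
    refine le_antisymm (Submodule.rank_mono (s := Subalgebra.toSubmodule
      (IntermediateField.adjoin F (U : Set E)).toSubalgebra) fun x hx => ?_)
      U.rank_le_rank_adjoin
    have hle : IntermediateField.adjoin F (U : Set E) ≤ S.toIntermediateField hmem :=
      IntermediateField.adjoin_le_iff.mpr hS.ge
    exact hS.le (hle hx)

end SubmoduleAdjoin

/-- The image of `W` under a linear map `f` is the quotient of `W` by `W ∩ ker f`. -/
noncomputable def Submodule.quotComapKerEquivMap {R M N : Type*} [Ring R] [AddCommGroup M]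
    [Module R M] [AddCommGroup N] [Module R N] (W : Submodule R M) (f : M →ₗ[R] N) :
    (W ⧸ (LinearMap.ker f).comap W.subtype) ≃ₗ[R] W.map f :=
  (Submodule.quotEquivOfEq _ _ (LinearMap.ker_comp W.subtype f).symm).trans
    ((f.comp W.subtype).quotKerEquivRange.trans
      (LinearEquiv.ofEq _ _ (by rw [LinearMap.range_comp, Submodule.range_subtype])))

theorem fieldext_dim (F : Type u) (E : Type v) [Field F] [Field E] [Algebra F E]
    (V : Type w) [AddCommGroup V] [Module E V] [Module F V] [IsScalarTower F E V]
    (C : Submodule E V) (hC : Module.finrank E (V ⧸ C) = 1)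
    (W : Submodule F V) (hW : ¬ (W : Set V) ⊆ (C : Set V))
    (φ : V →ₗ[E] E) (hφ : LinearMap.ker φ = C) (h1φ : (1 : E) ∈ ⇑φ '' (W : Set V)) :
    (IntermediateField.adjoin F (⇑φ '' (W : Set V)) = ⊥ ↔
      Module.rank F
        (↥W ⧸ (Submodule.comap W.subtype (Submodule.restrictScalars F C))) = 1) ∧
    (Cardinal.lift.{v}
        (Module.rank F
          (↥W ⧸ (Submodule.comap W.subtype (Submodule.restrictScalars F C)))) ≤
      Cardinal.lift.{w}
        (Module.rank F ↥(IntermediateField.adjoin F (⇑φ '' (W : Set V))))) ∧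
    (Module.rank F
        (↥W ⧸ (Submodule.comap W.subtype (Submodule.restrictScalars F C))) < Cardinal.aleph0 →
      (Cardinal.lift.{w}
          (Module.rank F ↥(IntermediateField.adjoin F (⇑φ '' (W : Set V)))) =
        Cardinal.lift.{v}
          (Module.rank F
            (↥W ⧸ (Submodule.comap W.subtype (Submodule.restrictScalars F C)))) ↔
        ∃ S : Subfield E, (S : Set E) = ⇑φ '' (W : Set V))) := by
  subst hφ
  have hrank := (W.quotComapKerEquivMap (φ.restrictScalars F)).lift_rank_eq
  rw [LinearMap.ker_restrictScalars] at hrank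
  have himage : ⇑φ '' (W : Set V) = (W.map (φ.restrictScalars F) : Submodule F E) := rfl
  rw [himage] at h1φ ⊢
  refine ⟨?_, ?_, fun hfin => ?_⟩
  · rw [Submodule.adjoin_eq_bot_iff_rank_eq_one h1φ, ← Cardinal.lift_eq_one.{v, w}, hrank,
      Cardinal.lift_eq_one]
  · rw [hrank, Cardinal.lift_le]
    exact Submodule.rank_le_rank_adjoin _
  · rw [hrank, Cardinal.lift_inj]
    refine Submodule.rank_adjoin_eq_iff_exists_subfield h1φ ?_
    rwa [← Cardinal.lift_lt_aleph0.{v, w}, ← hrank, Cardinal.lift_lt_aleph0]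
end

section
/- Let M be a Lie algebra of maximal class over a field E, let U be an additive subgroup of M_i for some i ≥ 2, and let x ∈ M_1 \ C_i. Then E_U = E_{[U,x]}, where [U,x] = {[u,x] : u ∈ U}. -/
set_option synthInstance.maxHeartbeats 1000000
set_option maxHeartbeats 1000000

/-- Bracketing with an element of degree one outside the two-step centraliser is injective on a
one-dimensional homogeneous component. -/
theorem eq_zero_of_lie_eq_zero_of_notMem_twoStepCent {E : Type*} [Field E] {M : Type*}
    [LieRing M] [LieAlgebra E M] {gr : ℕ → Submodule E M} {i : ℕ}
    (hdim : Module.finrank E ↥(gr i) = 1) {x : M} (hx1 : x ∈ gr 1)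
    (hx : x ∉ twoStepCent E gr i) {v : M} (hv : v ∈ gr i) (h : ⁅v, x⁆ = 0) : v = 0 := by
  by_contra hv0
  refine hx ⟨hx1, (Submodule.mem_iInf _).2 fun m => ?_⟩
  obtain ⟨c, hc⟩ := (finrank_eq_one_iff_of_nonzero' (⟨v, hv⟩ : ↥(gr i))
    (by simpa using hv0)).1 hdim m
  simp [← hc, h]

theorem precovering (E : Type*) [Field E] (M : Type*) [LieRing M] [LieAlgebra E M]
    (Mgr : ℕ → Submodule E M) (hM : IsMaxClass E Mgr)
    (i : ℕ) (hi : 2 ≤ i) (U : AddSubgroup M) (hU : (U : Set M) ⊆ (Mgr i : Set M))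
    (x : M) (hx1 : x ∈ Mgr 1) (hx : x ∉ twoStepCent E Mgr i) :
    scalarStab E (U : Set M) = scalarStab E {z | ∃ u ∈ U, z = ⁅u, x⁆} := by
  ext α
  constructor
  · rintro h _ ⟨u, hu, rfl⟩
    exact ⟨α • u, h u hu, (smul_lie α u x).symm⟩
  · intro h u hu
    obtain ⟨w, hw, hwx⟩ := h ⁅u, x⁆ ⟨u, hu, rfl⟩
    have hsub : α • u - w = 0 :=
      eq_zero_of_lie_eq_zero_of_notMem_twoStepCent (hM.dim_ge_two i hi) hx1 hx
        (sub_mem ((Mgr i).smul_mem α (hU hu)) (hU hw))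
        (by rw [sub_lie, smul_lie, hwx, sub_self])
    rw [sub_eq_zero.1 hsub]
    exact hw
end

section
/- Let L = ⊕_{i≥1} L_i be a graded Lie algebra over a field, generated by L_1, and let r be a positive integer. Then L is ideally r-constrained if and only if for every positive integer i and every nonzero homogeneous element z of degree i, [z, _r L_1] = L_{i+r}, where [z, _1 L_1] := [z, L_1] and [z, _k L_1] := [[z, _{k−1} L_1], L_1] for k ≥ 2. -/
set_option synthInstance.maxHeartbeats 1000000
set_option maxHeartbeats 1000000

section BracketIter

variable {R : Type*} [Field R] {L : Type*} [LieRing L]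

theorem lie_mem_bracketIter_succ [Module R L] {L1 X0 : Submodule R L} {k : ℕ} {x y : L}
    (hx : x ∈ bracketIter R L1 X0 k) (hy : y ∈ L1) :
    ⁅x, y⁆ ∈ bracketIter R L1 X0 (k + 1) :=
  Submodule.subset_span ⟨x, hx, y, hy, rfl⟩

theorem IsGradedIdealFam.bracketIter_le [Module R L] {gr J : ℕ → Submodule R L}
    (hJ : IsGradedIdealFam R gr J) {X0 : Submodule R L} {i : ℕ} (hX : X0 ≤ J i) (k : ℕ) :
    bracketIter R (gr 1) X0 k ≤ J (i + k) := by
  induction k with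
  | zero => exact hX
  | succ k ih =>
    refine Submodule.span_le.2 ?_
    rintro _ ⟨x, hx, y, hy, rfl⟩
    exact hJ.2 (i + k) 1 x (ih hx) y hy

theorem IsGradedLie.bracketIter_le [Module R L] {gr : ℕ → Submodule R L}
    (hL : IsGradedLie R gr) {X0 : Submodule R L} {i : ℕ} (hX : X0 ≤ gr i) (k : ℕ) :
    bracketIter R (gr 1) X0 k ≤ gr (i + k) :=
  IsGradedIdealFam.bracketIter_le ⟨fun _ => le_rfl, hL.bracket_mem⟩ hX k

variable [LieAlgebra R L] {gr : ℕ → Submodule R L}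

theorem IsGradedLie.lie_mem_bracketIter (hL : IsGradedLie R gr) (X0 : Submodule R L) (j : ℕ) :
    ∀ (k : ℕ), ∀ x ∈ bracketIter R (gr 1) X0 k, ∀ y ∈ gr j,
      ⁅x, y⁆ ∈ bracketIter R (gr 1) X0 (k + j) := by
  induction j with
  | zero =>
    intro k x _ y hy
    rw [hL.bot, Submodule.mem_bot] at hy
    simp [hy]
  | succ j ih =>
    intro k x hx y hy
    rcases Nat.eq_zero_or_pos j with rfl | hj
    · exact lie_mem_bracketIter_succ hx hy
    rw [hL.gen j hj] at hy
    induction hy using Submodule.span_induction with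
    | mem y hy =>
      obtain ⟨a, ha, b, hb, rfl⟩ := hy
      have hab : ⁅⁅x, a⁆, b⁆ ∈ bracketIter R (gr 1) X0 (k + (j + 1)) :=
        lie_mem_bracketIter_succ (ih k x hx a ha) hb
      have hba : ⁅⁅x, b⁆, a⁆ ∈ bracketIter R (gr 1) X0 (k + (j + 1)) := by
        have := ih (k + 1) _ (lie_mem_bracketIter_succ hx hb) a ha
        rwa [show k + 1 + j = k + (j + 1) by omega] at this
      have hjac : ⁅x, ⁅a, b⁆⁆ = ⁅⁅x, a⁆, b⁆ - ⁅⁅x, b⁆, a⁆ := by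
        rw [leibniz_lie, ← lie_skew a ⁅x, b⁆, sub_eq_add_neg]
      rw [hjac]
      exact sub_mem hab hba
    | zero => simp
    | add a b _ _ ha hb => rw [lie_add]; exact add_mem ha hb
    | smul c a _ ha => rw [lie_smul]; exact Submodule.smul_mem _ c ha

/-- The ideal generated by a subspace of `gr i` has homogeneous components obtained by iterated
bracketing with `gr 1`. -/
theorem IsGradedLie.isGradedIdealFam_bracketIter (hL : IsGradedLie R gr) {X0 : Submodule R L}
    {i : ℕ} (hX : X0 ≤ gr i) :
    IsGradedIdealFam R gr fun j => if i ≤ j then bracketIter R (gr 1) X0 (j - i) else ⊥ := by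
  refine ⟨fun j => ?_, fun m j z hz x hx => ?_⟩
  · dsimp only
    split_ifs with h
    · simpa [Nat.add_sub_cancel' h] using hL.bracketIter_le hX (j - i)
    · exact bot_le
  · dsimp only at hz ⊢
    split_ifs at hz with h
    · rw [if_pos (h.trans (Nat.le_add_right m j)), Nat.sub_add_comm h]
      exact hL.lie_mem_bracketIter X0 j _ z hz x hx
    · rw [Submodule.mem_bot] at hz
      simp [hz]

theorem IsGradedIdealFam.eq_of_le {J : ℕ → Submodule R L} (hL : IsGradedLie R gr)
    (hJ : IsGradedIdealFam R gr J) {m : ℕ} (hm : 1 ≤ m) (h : J m = gr m) {j : ℕ} (hj : m ≤ j) :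
    J j = gr j := by
  induction j, hj using Nat.le_induction with
  | base => exact h
  | succ j hj ih =>
    refine le_antisymm (hJ.1 _) ?_
    rw [hL.gen j (hm.trans hj)]
    refine Submodule.span_le.2 ?_
    rintro _ ⟨x, hx, y, hy, rfl⟩
    exact hJ.2 j 1 x (ih ▸ hx) y hy

end BracketIter

theorem constrained_iff_covering (R : Type*) [Field R] (L : Type*) [LieRing L] [LieAlgebra R L]
    (Lgr : ℕ → Submodule R L) (hL : IsGradedLie R Lgr)
    (hnz : ∀ i, 1 ≤ i → Lgr i ≠ ⊥) (r : ℕ) (hr : 1 ≤ r) :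
    IdeallyConstrained R Lgr r ↔
      ∀ i, 1 ≤ i → ∀ z ∈ Lgr i, z ≠ 0 →
        bracketIter R (Lgr 1) (Submodule.span R {z}) r = Lgr (i + r) := by
  constructor
  · intro h i _ z hz hz0
    have hX : Submodule.span R {z} ≤ Lgr i := by simpa using hz
    have hne : (if i ≤ i then bracketIter R (Lgr 1) (Submodule.span R {z}) (i - i) else ⊥) ≠ ⊥ := by
      simpa [bracketIter] using hz0
    obtain ⟨m, hlt, hge⟩ := h _ (hL.isGradedIdealFam_bracketIter hX) ⟨i, hne⟩
    have hmi : m ≤ i := not_lt.1 fun him => hne (hlt i him)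
    simpa using hge (i + r) (Nat.add_le_add_right hmi r)
  · classical
    intro h J hJ hex
    have hne := Nat.find_spec hex
    refine ⟨Nat.find hex, fun j hj => not_not.1 (Nat.find_min hex hj), fun j hj => ?_⟩
    generalize Nat.find hex = i at hne hj
    have hi : 1 ≤ i := by
      refine Nat.one_le_iff_ne_zero.2 ?_
      rintro rfl
      exact hne (le_bot_iff.1 (hL.bot ▸ hJ.1 0))
    obtain ⟨z, hz, hz0⟩ := Submodule.exists_mem_ne_zero_of_ne_bot hne
    have hX : Submodule.span R {z} ≤ J i := by simpa using hz
    refine hJ.eq_of_le hL (hi.trans (Nat.le_add_right i r)) (le_antisymm (hJ.1 _) ?_) hj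
    rw [← h i hi z (hJ.1 i hz) hz0]
    exact hJ.bracketIter_le hX r
end

section
/- Let E ⊋ F be fields with [E : F] finite, and let M be a Lie E-algebra of maximal class all of whose 2-step centralisers coincide (i.e. C_i = C_2 for all i ≥ 2; this is the metabelian Lie algebra of maximal class). Let L_1 be the F-subspace of M_1 spanned by an element x ∈ M_1 \ C_2 together with an F-subspace U of C_2 of dimension d ≥ 2. Then the Lie F-subalgebra of M generated by L_1 is not just infinite. -/
set_option synthInstance.maxHeartbeats 1000000
set_option maxHeartbeats 1000000

section Pair

variable {E M : Type*} [Field E] [AddCommGroup M] [Module E M]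

/-- A vector outside a subspace `C` of a plane `P` and a nonzero vector of `C` span `P`. -/
theorem Submodule.eq_span_pair_of_finrank_eq_two {P C : Submodule E M}
    (hP : Module.finrank E P = 2) (hCP : C ≤ P) {x y : M} (hxP : x ∈ P) (hxC : x ∉ C)
    (hyC : y ∈ C) (hy : y ≠ 0) : P = Submodule.span E {x, y} := by
  have hli : LinearIndependent E ![x, y] := by
    rw [LinearIndependent.pair_iff]
    intro s t h
    have hs : s = 0 := by
      by_contra hs
      have hsx : s • x ∈ C := by
        rw [eq_neg_of_add_eq_zero_left h]
        exact C.neg_mem (C.smul_mem t hyC)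
      exact hxC ((C.smul_mem_iff hs).1 hsx)
    subst hs
    simpa [hy] using h
  have hfin : FiniteDimensional E P := FiniteDimensional.of_finrank_pos (by omega)
  have hrank := finrank_span_eq_card hli
  rw [Matrix.range_cons_cons_empty] at hrank
  refine (Submodule.eq_of_le_of_finrank_eq ?_ (by rw [hrank, hP]; rfl)).symm
  rw [Submodule.span_le]
  rintro z (rfl | rfl)
  · exact hxP
  · exact hCP hyC

theorem Submodule.exists_smul_eq_of_finrank_eq_two {P C : Submodule E M}
    (hP : Module.finrank E P = 2) (hCP : C ≤ P) {x y : M} (hxP : x ∈ P) (hxC : x ∉ C)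
    (hyC : y ∈ C) (hy : y ≠ 0) {z : M} (hz : z ∈ C) : ∃ a : E, a • y = z := by
  have hzP := hCP hz
  rw [Submodule.eq_span_pair_of_finrank_eq_two hP hCP hxP hxC hyC hy,
    Submodule.mem_span_pair] at hzP
  obtain ⟨a, b, rfl⟩ := hzP
  have ha : a = 0 := by
    by_contra ha
    exact hxC ((C.smul_mem_iff ha).1 ((C.add_mem_iff_left (C.smul_mem b hyC)).1 hz))
  exact ⟨b, by simp [ha]⟩

end Pair

section LinearIndependence

variable {F E M : Type*} [Field F] [Field E] [Algebra F E] [AddCommGroup M] [Module E M]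
  [Module F M] [IsScalarTower F E M]

/-- If `e` is an infinite `E`-linearly independent family and `α ∈ E` is not in `F`, then an
`F`-subspace `S` containing all `α • e n` has infinite codimension over any `F`-subspace of the
`F`-span of `e`. -/
theorem not_finiteDimensional_quotient_of_smul_mem {ι : Type*} [Infinite ι] {e : ι → M}
    (he : LinearIndependent E e) {α : E} (hα : α ∉ Set.range (algebraMap F E))
    {S T : Submodule F M} (hS : ∀ n, α • e n ∈ S)
    (hT : T ≤ Submodule.span F (Set.range e)) :
    ¬ FiniteDimensional F (S ⧸ T.comap S.subtype) := by
  intro hfin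
  have hli : LinearIndependent F
      fun n => (T.comap S.subtype).mkQ (⟨α • e n, hS n⟩ : S) := by
    rw [linearIndependent_iff']
    intro s g hg i hi
    simp only [← map_smul, ← map_sum] at hg
    rw [Submodule.mkQ_apply, Submodule.Quotient.mk_eq_zero, Submodule.mem_comap] at hg
    obtain ⟨b, hb⟩ := (Finsupp.mem_span_range_iff_exists_finsupp).1 (hT hg)
    have hsum : S.subtype (∑ n ∈ s, g n • (⟨α • e n, hS n⟩ : S)) =
        ∑ n ∈ s, (algebraMap F E (g n) * α) • e n := by
      simp [map_sum, mul_smul]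
    have key : Finsupp.linearCombination E e
        (Finsupp.mapRange (algebraMap F E) (map_zero _) b) =
        Finsupp.linearCombination E e (∑ n ∈ s, Finsupp.single n (algebraMap F E (g n) * α)) := by
      rw [map_sum]
      simp only [Finsupp.linearCombination_single]
      rw [← hsum, ← hb, Finsupp.linearCombination_apply,
        Finsupp.sum_mapRange_index (by simp)]
      simp
    have hcoef := DFunLike.congr_fun (he key) i
    classical
    simp only [Finsupp.mapRange_apply, Finsupp.finsetSum_apply, Finsupp.single_apply,
      Finset.sum_ite_eq', hi, if_true] at hcoef
    by_contra hgi
    refine hα ⟨(g i)⁻¹ * b i, ?_⟩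
    rw [map_mul, hcoef, map_inv₀, inv_mul_cancel_left₀]
    simpa using hgi
  have := hli.finite_of_isNoetherian
  exact not_finite ι

end LinearIndependence

section Metabelian

variable {E M : Type*} [Field E] [LieRing M] [LieAlgebra E M] {Mgr : ℕ → Submodule E M}

/-- Bracketing on the right with `x`. -/
def rightBracket (E : Type*) {M : Type*} [Field E] [LieRing M] [LieAlgebra E M] (x : M) :
    M →ₗ[E] M := -(LieAlgebra.ad E M x : M →ₗ[E] M)

theorem rightBracket_apply (x w : M) : rightBracket E x w = ⁅w, x⁆ := by
  simp [rightBracket]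

theorem rightBracket_pow_succ_apply (x w : M) (n : ℕ) :
    (rightBracket E x ^ (n + 1)) w = ⁅(rightBracket E x ^ n) w, x⁆ := by
  rw [pow_succ', Module.End.mul_apply, rightBracket_apply]

theorem twoStepCent_le (i : ℕ) : twoStepCent E Mgr i ≤ Mgr 1 := inf_le_left

theorem lie_eq_zero_of_mem_twoStepCent {i : ℕ} {m c : M} (hm : m ∈ Mgr i)
    (hc : c ∈ twoStepCent E Mgr i) : ⁅m, c⁆ = 0 := by
  have h := (Submodule.mem_iInf _).1 (Submodule.mem_inf.1 hc).2 ⟨m, hm⟩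
  simpa using h

theorem IsMaxClass.component_eq_span_singleton (hM : IsMaxClass E Mgr)
    (hmeta : ∀ i, 2 ≤ i → twoStepCent E Mgr i = twoStepCent E Mgr 2) {x y : M}
    (hx1 : x ∈ Mgr 1) (hx : x ∉ twoStepCent E Mgr 2) (hy : y ∈ twoStepCent E Mgr 2)
    (hy0 : y ≠ 0) (n : ℕ) :
    Mgr (n + 2) = Submodule.span E {(rightBracket E x ^ (n + 1)) y} := by
  have hspan := Submodule.eq_span_pair_of_finrank_eq_two hM.dim_one (twoStepCent_le 2)
    hx1 hx hy hy0
  have hle : Mgr (n + 2) ≤ Submodule.span E {(rightBracket E x ^ (n + 1)) y} := by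
    induction n with
    | zero =>
      rw [hM.graded.gen 1 le_rfl, Submodule.span_le]
      rintro _ ⟨v, hv, w, hw, rfl⟩
      rw [hspan, Submodule.mem_span_pair] at hv hw
      obtain ⟨a, b, rfl⟩ := hv
      obtain ⟨c, d, rfl⟩ := hw
      refine Submodule.mem_span_singleton.2 ⟨b * c - a * d, ?_⟩
      simp only [rightBracket_pow_succ_apply, pow_zero, Module.End.one_apply, lie_add, add_lie,
        lie_smul, smul_lie, lie_self, smul_zero]
      rw [← lie_skew x y]
      module
    | succ n ih =>
      rw [hM.graded.gen (n + 2) (by omega), Submodule.span_le]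
      rintro _ ⟨v, hv, w, hw, rfl⟩
      have hvy : ⁅v, y⁆ = 0 :=
        lie_eq_zero_of_mem_twoStepCent hv (by rwa [hmeta (n + 2) (by omega)])
      obtain ⟨a, rfl⟩ := Submodule.mem_span_singleton.1 (ih hv)
      rw [hspan, Submodule.mem_span_pair] at hw
      obtain ⟨c, d, rfl⟩ := hw
      refine Submodule.mem_span_singleton.2 ⟨c * a, ?_⟩
      rw [lie_add, lie_smul, lie_smul, hvy, smul_lie, rightBracket_pow_succ_apply _ _ (n + 1)]
      module
  have hfin : FiniteDimensional E (Submodule.span E {(rightBracket E x ^ (n + 1)) y}) :=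
    inferInstance
  refine Submodule.eq_of_le_of_finrank_le hle ?_
  rw [hM.dim_ge_two (n + 2) (by omega)]
  exact (finrank_span_le_card _).trans (by simp)

theorem IsMaxClass.rightBracket_pow_ne_zero (hM : IsMaxClass E Mgr)
    (hmeta : ∀ i, 2 ≤ i → twoStepCent E Mgr i = twoStepCent E Mgr 2) {x y : M}
    (hx1 : x ∈ Mgr 1) (hx : x ∉ twoStepCent E Mgr 2) (hy : y ∈ twoStepCent E Mgr 2)
    (hy0 : y ≠ 0) (n : ℕ) :
    (rightBracket E x ^ (n + 1)) y ≠ 0 := by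
  intro h
  have hdim := hM.dim_ge_two (n + 2) (by omega)
  rw [hM.component_eq_span_singleton hmeta hx1 hx hy hy0 n, h] at hdim
  rw [Submodule.span_zero_singleton, finrank_bot] at hdim
  omega

theorem IsMaxClass.linearIndependent_rightBracket_pow (hM : IsMaxClass E Mgr)
    (hmeta : ∀ i, 2 ≤ i → twoStepCent E Mgr i = twoStepCent E Mgr 2) {x y : M}
    (hx1 : x ∈ Mgr 1) (hx : x ∉ twoStepCent E Mgr 2) (hy : y ∈ twoStepCent E Mgr 2)
    (hy0 : y ≠ 0) :
    LinearIndependent E fun n => (rightBracket E x ^ (n + 1)) y := by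
  refine iSupIndep.linearIndependent (fun n => Mgr (n + 2))
    (hM.graded.internal.submodule_iSupIndep.comp (add_left_injective 2)) (fun n => ?_)
    (hM.rightBracket_pow_ne_zero hmeta hx1 hx hy hy0)
  rw [hM.component_eq_span_singleton hmeta hx1 hx hy hy0 n]
  exact Submodule.mem_span_singleton_self _

/-- Components of degree at least two commute with each other. -/
theorem IsMaxClass.lie_eq_zero_of_two_le (hM : IsMaxClass E Mgr)
    (hmeta : ∀ i, 2 ≤ i → twoStepCent E Mgr i = twoStepCent E Mgr 2) {x y : M}
    (hx1 : x ∈ Mgr 1) (hx : x ∉ twoStepCent E Mgr 2) (hy : y ∈ twoStepCent E Mgr 2)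
    (hy0 : y ≠ 0) {i j : ℕ} (hi : 2 ≤ i) (hj : 2 ≤ j) {m n : M}
    (hm : m ∈ Mgr i) (hn : n ∈ Mgr j) : ⁅m, n⁆ = 0 := by
  obtain ⟨k, rfl⟩ := Nat.exists_eq_add_of_le' hj
  suffices h : ∀ k i, 2 ≤ i → ∀ m ∈ Mgr i, ⁅m, (rightBracket E x ^ (k + 1)) y⁆ = 0 by
    rw [hM.component_eq_span_singleton hmeta hx1 hx hy hy0 k] at hn
    obtain ⟨a, rfl⟩ := Submodule.mem_span_singleton.1 hn
    rw [lie_smul, h k i hi m hm, smul_zero]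
  intro k
  induction k with
  | zero =>
    intro i hi m hm
    have hcent : ∀ i, 2 ≤ i → ∀ m ∈ Mgr i, ⁅m, y⁆ = 0 := fun i hi m hm =>
      lie_eq_zero_of_mem_twoStepCent hm (by rwa [hmeta i hi])
    have hmx := hcent (i + 1) (by omega) _ (hM.graded.bracket_mem i 1 m hm x hx1)
    rw [rightBracket_pow_succ_apply, pow_zero, Module.End.one_apply, leibniz_lie,
      hcent i hi m hm, zero_lie, zero_add, ← lie_skew, hmx, neg_zero]
  | succ k ih =>
    intro i hi m hm
    have hmx := ih (i + 1) (by omega) _ (hM.graded.bracket_mem i 1 m hm x hx1)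
    rw [rightBracket_pow_succ_apply, leibniz_lie, ih i hi m hm, zero_lie, zero_add,
      ← lie_skew, hmx, neg_zero]

end Metabelian

section GradedPieces

variable {F E M : Type*} [Field F] [Field E] [LieRing M] [LieAlgebra E M] [Module F M]

theorem gradedPieces_add_two (L1 : Submodule F M) (n : ℕ) :
    gradedPieces F L1 (n + 2) =
      Submodule.span F {z | ∃ x ∈ gradedPieces F L1 (n + 1), ∃ y ∈ L1, z = ⁅x, y⁆} := rfl

theorem gradedPieces_subset [Algebra F E] [IsScalarTower F E M] {Mgr : ℕ → Submodule E M}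
    (hM : IsGradedLie E Mgr) {L1 : Submodule F M} (hL1 : ∀ z ∈ L1, z ∈ Mgr 1) (i : ℕ) :
    gradedPieces F L1 i ≤ (Mgr i).restrictScalars F := by
  induction i with
  | zero => exact bot_le
  | succ n ih =>
    cases n with
    | zero => exact hL1
    | succ n =>
      rw [gradedPieces_add_two, Submodule.span_le]
      rintro _ ⟨v, hv, w, hw, rfl⟩
      exact hM.bracket_mem (n + 1) 1 v (ih hv) w (hL1 w hw)

theorem rightBracket_pow_mem_gradedPieces {L1 : Submodule F M} {x u : M} (hx : x ∈ L1)
    (hu : u ∈ L1) (n : ℕ) : (rightBracket E x ^ n) u ∈ gradedPieces F L1 (n + 1) := by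
  induction n with
  | zero => simpa [gradedPieces] using hu
  | succ n ih =>
    rw [rightBracket_pow_succ_apply, gradedPieces_add_two]
    exact Submodule.subset_span ⟨_, ih, x, hx, rfl⟩

end GradedPieces

theorem notjustinfinite (F E : Type*) [Field F] [Field E] [Algebra F E]
    [FiniteDimensional F E] (hEF : 1 < Module.finrank F E)
    (M : Type*) [LieRing M] [LieAlgebra E M] [Module F M] [IsScalarTower F E M]
    (Mgr : ℕ → Submodule E M) (hM : IsMaxClass E Mgr)
    (hmeta : ∀ i, 2 ≤ i → twoStepCent E Mgr i = twoStepCent E Mgr 2)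
    (x : M) (hx1 : x ∈ Mgr 1) (hx : x ∉ twoStepCent E Mgr 2)
    (U : Submodule F M) (hU : (U : Set M) ⊆ (twoStepCent E Mgr 2 : Set M))
    (hUfin : FiniteDimensional F ↥U)
    (d : ℕ) (hd : 2 ≤ d) (hdim : Module.finrank F ↥U = d) :
    ¬ JustInfinite F (gradedPieces F (Submodule.span F {x} ⊔ U)) := by
  have hUC : ∀ u ∈ U, u ∈ twoStepCent E Mgr 2 := fun u hu => hU hu
  have hne : U ≠ ⊥ := by
    rintro rfl
    simp at hdim
    omega
  obtain ⟨y, hyU, hy0⟩ := Submodule.exists_mem_ne_zero_of_ne_bot hne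
  have hy := hUC y hyU
  obtain ⟨u, huU, hu⟩ : ∃ u ∈ U, u ∉ Submodule.span F {y} := by
    by_contra! h
    have hle : Module.finrank F U ≤ Module.finrank F (Submodule.span F {y}) :=
      Submodule.finrank_mono h
    rw [finrank_span_singleton hy0] at hle
    omega
  obtain ⟨α, rfl⟩ := Submodule.exists_smul_eq_of_finrank_eq_two hM.dim_one (twoStepCent_le 2)
    hx1 hx hy hy0 (hUC u huU)
  have hα : α ∉ Set.range (algebraMap F E) := by
    rintro ⟨a, rfl⟩
    exact hu (Submodule.mem_span_singleton.2 ⟨a, by rw [algebraMap_smul]⟩)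
  set L1 : Submodule F M := Submodule.span F {x} ⊔ U
  have hxL : x ∈ L1 := Submodule.mem_sup_left (Submodule.mem_span_singleton_self x)
  have hUL : U ≤ L1 := le_sup_right
  have hL1 : ∀ z ∈ L1, z ∈ Mgr 1 := by
    have hle : L1 ≤ (Mgr 1).restrictScalars F :=
      sup_le ((Submodule.span_singleton_le_iff_mem _ _).2 hx1)
        fun v hv => twoStepCent_le 2 (hUC v hv)
    exact hle
  have hpieces := gradedPieces_subset hM.graded hL1
  let e : ℕ → M := fun n => (rightBracket E x ^ n) y
  let J : ℕ → Submodule F M := fun i => if 2 ≤ i then Submodule.span F {e (i - 1)} else ⊥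
  have hJ : ∀ n, J (n + 2) = Submodule.span F {e (n + 1)} := fun n => by simp [J]
  have hJlow : ∀ i, ¬ 2 ≤ i → J i = ⊥ := fun i hi => if_neg hi
  have hJle : ∀ i, J i ≤ gradedPieces F L1 i := by
    intro i
    by_cases hi : 2 ≤ i
    · obtain ⟨n, rfl⟩ := Nat.exists_eq_add_of_le' hi
      rw [hJ, Submodule.span_singleton_le_iff_mem]
      exact rightBracket_pow_mem_gradedPieces hxL (hUL hyU) (n + 1)
    · rw [hJlow i hi]
      exact bot_le
  have hideal : IsGradedIdealFam F (gradedPieces F L1) J := by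
    refine ⟨hJle, fun i j z hz w hw => ?_⟩
    by_cases hi : 2 ≤ i
    swap
    · rw [hJlow i hi, Submodule.mem_bot] at hz
      simp [hz]
    have hzM : z ∈ Mgr i := hpieces i (hJle i hz)
    match j, hw with
    | 0, hw =>
      have hw0 : w = 0 := hw
      simp [hw0]
    | 1, hw =>
      obtain ⟨n, rfl⟩ := Nat.exists_eq_add_of_le' hi
      obtain ⟨p, hp, v, hv, rfl⟩ := Submodule.mem_sup.1 (show w ∈ L1 from hw)
      obtain ⟨b, rfl⟩ := Submodule.mem_span_singleton.1 hp
      have hzv : ⁅z, v⁆ = 0 := lie_eq_zero_of_mem_twoStepCent hzM (by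
        rw [hmeta _ hi]
        exact hUC v hv)
      rw [hJ] at hz
      obtain ⟨a, rfl⟩ := Submodule.mem_span_singleton.1 hz
      rw [show n + 2 + 1 = n + 1 + 2 from rfl, hJ]
      refine Submodule.mem_span_singleton.2 ⟨b * a, ?_⟩
      rw [lie_add, hzv, add_zero, mul_smul]
      simp only [← algebraMap_smul E a, ← algebraMap_smul E b, lie_smul, smul_lie, e]
      rw [rightBracket_pow_succ_apply x y (n + 1)]
    | j + 2, hw =>
      rw [hM.lie_eq_zero_of_two_le hmeta hx1 hx hy hy0 hi (by omega) hzM (hpieces _ hw)]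
      exact Submodule.zero_mem _
  intro hjust
  refine not_finiteDimensional_quotient_of_smul_mem
    (hM.linearIndependent_rightBracket_pow hmeta hx1 hx hy hy0) hα (fun n => ?_)
    (iSup_le fun i => ?_) (hjust J hideal ⟨2, ?_⟩)
  · rw [← map_smul]
    exact Submodule.mem_iSup_of_mem (n + 2)
      (rightBracket_pow_mem_gradedPieces hxL (hUL huU) (n + 1))
  · by_cases hi : 2 ≤ i
    · obtain ⟨n, rfl⟩ := Nat.exists_eq_add_of_le' hi
      rw [hJ, Submodule.span_singleton_le_iff_mem]
      exact Submodule.subset_span ⟨n, rfl⟩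
    · rw [hJlow i hi]
      exact bot_le
  · rw [hJ 0, Ne, Submodule.span_singleton_eq_bot]
    exact hM.rightBracket_pow_ne_zero hmeta hx1 hx hy hy0 0
end

section
/- Let E ⊇ F be fields, M a Lie E-algebra of maximal class, and L_1 an F-subspace of M_1 with dim_F L_1 = 2 and E·L_1 = M_1; assume the 2-step field K of L is a finite extension of F. Then the Lie F-subalgebra L of M generated by L_1 is ideally r-constrained for some positive integer r. -/
set_option synthInstance.maxHeartbeats 1000000
set_option maxHeartbeats 1000000

section ProductChains

variable {F E : Type*} [Field F] [Field E] [Algebra F E] {P : ℕ → Submodule F E}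

theorem mul_mem_of_recurrent
    (hrec : ∀ m, ∃ B, ∀ n, ∃ j, n ≤ j ∧ j ≤ n + B ∧ ∃ c : E, c ≠ 0 ∧ ∀ a ∈ P m, c * a ∈ P j)
    (m : ℕ) :
    ∃ R, ∀ V : ℕ → Submodule F E, Monotone V → (∀ n, V n * P n ≤ V (n + 1)) →
      ∀ n, V n ≠ ⊥ → ∃ c : E, c ≠ 0 ∧ ∀ a ∈ ∏ k ∈ Finset.range m, P k, c * a ∈ V (n + R) := by
  induction m with
  | zero =>
    refine ⟨0, fun V _ _ n hn => ?_⟩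
    obtain ⟨v, hv, hv0⟩ := Submodule.exists_mem_ne_zero_of_ne_bot hn
    refine ⟨v, hv0, fun a ha => ?_⟩
    rw [Finset.range_zero, Finset.prod_empty, Submodule.mem_one] at ha
    obtain ⟨b, rfl⟩ := ha
    rw [mul_comm, ← Algebra.smul_def]
    exact Submodule.smul_mem _ _ hv
  | succ m ih =>
    obtain ⟨R, hR⟩ := ih
    obtain ⟨B, hB⟩ := hrec m
    refine ⟨R + B + 1, fun V hmono hV n hn => ?_⟩
    obtain ⟨c, hc, hcV⟩ := hR V hmono hV n hn
    obtain ⟨j, hj, hjB, c', hc', hP⟩ := hB (n + R)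
    refine ⟨c * c', mul_ne_zero hc hc', fun a ha => ?_⟩
    rw [Finset.prod_range_succ] at ha
    refine hmono (show j + 1 ≤ n + (R + B + 1) by omega) ?_
    induction ha using Submodule.mul_induction_on' with
    | mem_mul_mem a ha b hb =>
      refine hV j ?_
      rw [mul_mul_mul_comm]
      exact Submodule.mul_mem_mul (hmono hj (hcV a ha)) (hP b hb)
    | add a _ b _ iha ihb =>
      rw [mul_add]
      exact add_mem iha ihb

theorem eq_prod_of_recurrent (A : Submodule F E) [FiniteDimensional F A]
    (hone : ∀ n, (1 : E) ∈ P n) (hA : ∀ n, ∏ k ∈ Finset.range n, P k ≤ A)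
    (hrec : ∀ m, ∃ B, ∀ n, ∃ j, n ≤ j ∧ j ≤ n + B ∧ ∃ c : E, c ≠ 0 ∧ ∀ a ∈ P m, c * a ∈ P j) :
    ∃ R, ∀ V : ℕ → Submodule F E, (∀ n, V n * P n ≤ V (n + 1)) →
      (∀ n, V n ≤ ∏ k ∈ Finset.range n, P k) →
      ∀ n, V n ≠ ⊥ → ∀ k, n + R ≤ k → V k = ∏ k ∈ Finset.range k, P k := by
  set W : ℕ → Submodule F E := fun n => ∏ k ∈ Finset.range n, P k
  have hfin : ∀ n, FiniteDimensional F (W n) := fun n =>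
    Submodule.finiteDimensional_of_le (hA n)
  obtain ⟨N, hN⟩ : ∃ N, ∀ k, Module.finrank F (W k) ≤ Module.finrank F (W N) := by
    have hbdd : BddAbove (Set.range fun n => Module.finrank F (W n)) := by
      refine ⟨Module.finrank F A, ?_⟩
      rintro _ ⟨n, rfl⟩
      exact Submodule.finrank_mono (hA n)
    obtain ⟨N, hN⟩ := Nat.sSup_mem (Set.range_nonempty _) hbdd
    refine ⟨N, fun k => ?_⟩
    have := le_csSup hbdd (Set.mem_range_self k)
    simp only at hN this
    omega
  obtain ⟨R, hR⟩ := mul_mem_of_recurrent hrec N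
  refine ⟨R, fun V hV hVW n hn k hk => ?_⟩
  have hmono : Monotone V := monotone_nat_of_le_succ fun n a ha => by
    have := hV n (Submodule.mul_mem_mul ha (hone n))
    rwa [mul_one] at this
  obtain ⟨c, hc, hcV⟩ := hR V hmono hV n hn
  refine Submodule.eq_of_le_of_finrank_le (hVW k) ?_
  have hinj : Function.Injective (LinearMap.mulLeft F c) := fun a b h =>
    mul_left_cancel₀ hc h
  have hle : (W N).map (LinearMap.mulLeft F c) ≤ V k := by
    rintro _ ⟨a, ha, rfl⟩
    exact hmono hk (hcV a ha)
  have hVfin : FiniteDimensional F (V k) := Submodule.finiteDimensional_of_le (hVW k)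
  calc Module.finrank F (W k) ≤ Module.finrank F (W N) := hN k
    _ = Module.finrank F ((W N).map (LinearMap.mulLeft F c)) :=
        (Submodule.equivMapOfInjective _ hinj (W N)).finrank_eq
    _ ≤ Module.finrank F (V k) := Submodule.finrank_mono hle

end ProductChains

section MaximalClass

variable {E : Type*} [Field E] {M : Type*} [LieRing M] [LieAlgebra E M] {Mgr : ℕ → Submodule E M}

theorem IsMaxClass.exists_lie_ne_zero (hM : IsMaxClass E Mgr) {S : Set M}
    (hspan : Submodule.span E S = Mgr 1) {i : ℕ} (hi : 2 ≤ i) {e : M} (he : e ∈ Mgr i)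
    (he0 : e ≠ 0) : ∃ l ∈ S, ⁅e, l⁆ ≠ 0 := by
  by_contra! h
  have hzero : ∀ v ∈ Mgr 1, ⁅e, v⁆ = 0 := by
    have hle : Submodule.span E S ≤ LinearMap.ker (LieAlgebra.ad E M e) :=
      Submodule.span_le.2 fun l hl => h l hl
    intro v hv
    exact hle (hspan ▸ hv)
  have hbot : Mgr (i + 1) = ⊥ := by
    rw [hM.graded.gen i (by omega), Submodule.span_eq_bot]
    rintro _ ⟨x, hx, y, hy, rfl⟩
    obtain ⟨a, ha⟩ := exists_smul_eq_of_finrank_eq_one (hM.dim_ge_two i hi)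
      (x := (⟨e, he⟩ : Mgr i)) (by simpa using he0) ⟨x, hx⟩
    have hax : a • e = x := congrArg Subtype.val ha
    rw [← hax, smul_lie, hzero y hy, smul_zero]
  have := hM.dim_ge_two (i + 1) (by omega)
  rw [hbot, finrank_bot] at this
  omega

/-- A homogeneous basis `d n ∈ M_(n+2)` normalised by elements `l n` of a spanning set of `M_1`,
with the functionals `φ n` describing the action of `M_1` on it. -/
structure IsAdaptedBasis (Mgr : ℕ → Submodule E M) (S : Set M) (d l : ℕ → M)
    (φ : ℕ → M →ₗ[E] E) : Prop where
  mem : ∀ n, d n ∈ Mgr (n + 2)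
  ne_zero : ∀ n, d n ≠ 0
  exists_smul : ∀ n, ∀ m ∈ Mgr (n + 2), ∃ a : E, a • d n = m
  lie_eq : ∀ n, ∀ v ∈ Mgr 1, ⁅d n, v⁆ = φ n v • d (n + 1)
  l_mem : ∀ n, l n ∈ S
  apply_l : ∀ n, φ n (l n) = 1

theorem IsMaxClass.exists_isAdaptedBasis (hM : IsMaxClass E Mgr) {S : Set M}
    (hspan : Submodule.span E S = Mgr 1) {e : M} (he : e ∈ Mgr 2) (he0 : e ≠ 0) :
    ∃ d l φ, IsAdaptedBasis Mgr S d l φ ∧ d 0 = e := by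
  have hS : ∀ v ∈ S, v ∈ Mgr 1 := fun v hv => hspan ▸ Submodule.subset_span hv
  have hstep : ∀ n, ∀ x : M, x ∈ Mgr (n + 2) ∧ x ≠ 0 → ∃ l ∈ S, ⁅x, l⁆ ≠ 0 :=
    fun n x hx => hM.exists_lie_ne_zero hspan (by omega) hx.1 hx.2
  choose! f hfS hf0 using hstep
  let d : ℕ → M := fun n => Nat.rec e (fun n x => ⁅x, f n x⁆) n
  have hdsucc : ∀ n, d (n + 1) = ⁅d n, f n (d n)⁆ := fun n => rfl
  have hd : ∀ n, d n ∈ Mgr (n + 2) ∧ d n ≠ 0 := by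
    intro n
    induction n with
    | zero => exact ⟨he, he0⟩
    | succ n ih =>
      rw [hdsucc]
      exact ⟨hM.graded.bracket_mem (n + 2) 1 _ ih.1 _ (hS _ (hfS n _ ih)), hf0 n _ ih⟩
  have hsmul : ∀ n, ∀ m ∈ Mgr (n + 2), ∃ a : E, a • d n = m := by
    intro n m hm
    obtain ⟨a, ha⟩ := exists_smul_eq_of_finrank_eq_one (hM.dim_ge_two (n + 2) (by omega))
      (x := (⟨d n, (hd n).1⟩ : Mgr (n + 2))) (by simpa using (hd n).2) ⟨m, hm⟩
    exact ⟨a, congrArg Subtype.val ha⟩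
  have hψ : ∀ n, ∃ ψ : M →ₗ[E] E, ψ (d (n + 1)) = 1 := by
    intro n
    exact Module.Projective.exists_dual_eq_one E (hd (n + 1)).2
  choose ψ hψ using hψ
  have hlie : ∀ n, ∀ v ∈ Mgr 1, ⁅d n, v⁆ = ψ n ⁅d n, v⁆ • d (n + 1) := by
    intro n v hv
    obtain ⟨a, ha⟩ := hsmul (n + 1) _ (hM.graded.bracket_mem (n + 2) 1 _ (hd n).1 _ hv)
    rw [← ha, map_smul, hψ, smul_eq_mul, mul_one]
  exact ⟨d, fun n => f n (d n), fun n => ψ n ∘ₗ LieAlgebra.ad E M (d n),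
    { mem := fun n => (hd n).1
      ne_zero := fun n => (hd n).2
      exists_smul := hsmul
      lie_eq := hlie
      l_mem := fun n => hfS n _ (hd n)
      apply_l := fun n => hψ n }, rfl⟩

namespace IsAdaptedBasis

variable {S : Set M} {d l : ℕ → M} {φ : ℕ → M →ₗ[E] E}

theorem apply_eq_zero_iff (h : IsAdaptedBasis Mgr S d l φ) (n : ℕ) {v : M} (hv : v ∈ Mgr 1) :
    φ n v = 0 ↔ v ∈ twoStepCent E Mgr (n + 2) := by
  simp only [twoStepCent, Submodule.mem_inf, hv, true_and, Submodule.mem_iInf, LinearMap.mem_ker,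
    LieAlgebra.ad_apply]
  constructor
  · rintro h0 ⟨m, hm⟩
    obtain ⟨a, rfl⟩ := h.exists_smul n m hm
    rw [smul_lie, h.lie_eq n v hv, h0, zero_smul, smul_zero]
  · intro h0
    have := h0 ⟨d n, h.mem n⟩
    rw [h.lie_eq n v hv] at this
    exact (smul_eq_zero.1 this).resolve_right (h.ne_zero _)

/-- If `z` centralises both `M_(m+2)` and `M_(k+2)`, it centralises one of the next `m + 2`
components after `M_(k+2)`, because `[w, z, …, z]` vanishes with `m + 2` factors `z`. -/
theorem exists_next_apply_eq_zero (h : IsAdaptedBasis Mgr S d l φ) (hM : IsMaxClass E Mgr)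
    (hS : ∀ v ∈ S, v ∈ Mgr 1) {m k : ℕ} {z : M} (hz : z ∈ Mgr 1) (hm : φ m z = 0)
    (hk : φ k z = 0) : ∃ j, k + 1 ≤ j ∧ j ≤ k + m + 2 ∧ φ j z = 0 := by
  by_contra! hne
  let ρ : M → M := fun x => ⁅x, z⁆
  have hkz : ⁅d k, z⁆ = 0 := by rw [h.lie_eq k z hz, hk, zero_smul]
  have hcomm : ∀ j, ⁅d k, ρ^[j] (l k)⁆ = ρ^[j] (d (k + 1)) := by
    intro j
    induction j with
    | zero => simp [h.lie_eq k _ (hS _ (h.l_mem k)), h.apply_l k]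
    | succ j ih =>
      rw [Function.iterate_succ_apply', Function.iterate_succ_apply', ← ih]
      change ⁅d k, ⁅ρ^[j] (l k), z⁆⁆ = ⁅⁅d k, ρ^[j] (l k)⁆, z⁆
      rw [leibniz_lie, hkz, lie_zero, add_zero]
  have hmem : ∀ j, ρ^[j] (l k) ∈ Mgr (j + 1) := by
    intro j
    induction j with
    | zero => exact hS _ (h.l_mem k)
    | succ j ih =>
      rw [Function.iterate_succ_apply']
      exact hM.graded.bracket_mem (j + 1) 1 _ ih _ hz
  have hzero : ρ^[m + 2] (l k) = 0 := by
    obtain ⟨a, ha⟩ := h.exists_smul m _ (hmem (m + 1))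
    rw [Function.iterate_succ_apply', ← ha]
    change ⁅a • d m, z⁆ = 0
    rw [smul_lie, h.lie_eq m z hz, hm, zero_smul, smul_zero]
  have hiter : ∀ j, j ≤ m + 2 → ∃ a : E, a ≠ 0 ∧ ρ^[j] (d (k + 1)) = a • d (k + 1 + j) := by
    intro j
    induction j with
    | zero => exact fun _ => ⟨1, one_ne_zero, by simp⟩
    | succ j ih =>
      intro hj
      obtain ⟨a, ha, hja⟩ := ih (by omega)
      refine ⟨a * φ (k + 1 + j) z, mul_ne_zero ha (hne _ (by omega) (by omega)), ?_⟩
      rw [Function.iterate_succ_apply', hja]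
      change ⁅a • d (k + 1 + j), z⁆ = _
      rw [smul_lie, h.lie_eq _ z hz, smul_smul, ← add_assoc]
  obtain ⟨a, ha, hja⟩ := hiter (m + 2) le_rfl
  rw [← hcomm, hzero, lie_zero] at hja
  exact smul_ne_zero ha (h.ne_zero _) hja.symm

theorem exists_apply_eq_zero (h : IsAdaptedBasis Mgr S d l φ) (hM : IsMaxClass E Mgr)
    (hS : ∀ v ∈ S, v ∈ Mgr 1) {m : ℕ} {z : M} (hz : z ∈ Mgr 1) (hm : φ m z = 0) (n : ℕ) :
    ∃ j, n ≤ j ∧ j ≤ n + (m + 2) ∧ φ j z = 0 := by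
  induction n with
  | zero => exact ⟨m, by omega, by omega, hm⟩
  | succ n ih =>
    obtain ⟨j, hj, hj', hjz⟩ := ih
    rcases hj.eq_or_lt with rfl | hlt
    · obtain ⟨i, hi, hi', hiz⟩ := h.exists_next_apply_eq_zero hM hS hz hm hjz
      exact ⟨i, hi, by omega, hiz⟩
    · exact ⟨j, hlt, by omega, hjz⟩

theorem exists_proportional (h : IsAdaptedBasis Mgr S d l φ) (hM : IsMaxClass E Mgr)
    (hS : ∀ v ∈ S, v ∈ Mgr 1) (m n : ℕ) :
    ∃ j, n ≤ j ∧ j ≤ n + (m + 2) ∧ ∃ c : E, c ≠ 0 ∧ ∀ v ∈ Mgr 1, φ j v = c * φ m v := by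
  have hfin : FiniteDimensional E (Mgr 1) :=
    Module.finite_of_finrank_pos (by rw [hM.dim_one]; omega)
  let g : Mgr 1 →ₗ[E] E := φ m ∘ₗ (Mgr 1).subtype
  have hlm : ∀ i, l i ∈ Mgr 1 := fun i => hS _ (h.l_mem i)
  have hsurj : Function.Surjective g := fun a =>
    ⟨a • ⟨l m, hlm m⟩, by simp [g, h.apply_l m]⟩
  have hker : Module.finrank E (LinearMap.ker g) = 1 := by
    have := LinearMap.finrank_range_add_finrank_ker g
    rw [LinearMap.range_eq_top.2 hsurj, finrank_top, Module.finrank_self, hM.dim_one] at this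
    omega
  obtain ⟨⟨⟨z, hz⟩, hgz⟩, -, hspan⟩ := finrank_eq_one_iff'.1 hker
  have hmz : φ m z = 0 := hgz
  obtain ⟨j, hj, hj', hjz⟩ := h.exists_apply_eq_zero hM hS hz hmz n
  have hprop : ∀ v ∈ Mgr 1, φ j v = φ j (l m) * φ m v := by
    intro v hv
    have hu : v - φ m v • l m ∈ Mgr 1 := sub_mem hv (Submodule.smul_mem _ _ (hlm m))
    obtain ⟨a, ha⟩ := hspan ⟨⟨v - φ m v • l m, hu⟩, by simp [g, h.apply_l m]⟩
    have ha' : a • z = v - φ m v • l m := congrArg (fun x : LinearMap.ker g => ((x : Mgr 1) : M)) ha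
    have := congrArg (φ j) ha'
    rw [map_smul, hjz, smul_zero, map_sub, map_smul, smul_eq_mul] at this
    rw [mul_comm]
    exact (sub_eq_zero.1 this.symm)
  refine ⟨j, hj, hj', φ j (l m), fun h0 => ?_, hprop⟩
  have := hprop (l j) (hlm j)
  rw [h.apply_l, h0, zero_mul] at this
  exact one_ne_zero this

end IsAdaptedBasis

end MaximalClass

section Descent

variable {F E : Type*} [Field F] [Field E] [Algebra F E] {M : Type*} [LieRing M] [LieAlgebra E M]
  [Module F M] [IsScalarTower F E M] {Mgr : ℕ → Submodule E M} {L₁ : Submodule F M}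

theorem gradedPieces_eq_map {S : Set M} {d l : ℕ → M} {φ : ℕ → M →ₗ[E] E}
    (h : IsAdaptedBasis Mgr S d l φ) (hL₁ : ∀ v ∈ L₁, v ∈ Mgr 1)
    (h2 : gradedPieces F L₁ 2 = Submodule.span F {d 0}) (n : ℕ) :
    gradedPieces F L₁ (n + 2) =
      (∏ k ∈ Finset.range n, L₁.map ((φ k).restrictScalars F)).map
        ((LinearMap.toSpanSingleton E M (d n)).restrictScalars F) := by
  induction n with
  | zero =>
    rw [h2, Finset.range_zero, Finset.prod_empty, Submodule.one_eq_span, Submodule.map_span,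
      Set.image_singleton]
    simp
  | succ n ih =>
    rw [Finset.prod_range_succ]
    apply le_antisymm
    · refine Submodule.span_le.2 ?_
      rintro _ ⟨x, hx, y, hy, rfl⟩
      rw [ih] at hx
      obtain ⟨a, ha, rfl⟩ := hx
      refine ⟨a * φ n y, Submodule.mul_mem_mul ha ⟨y, hy, rfl⟩, ?_⟩
      simp [h.lie_eq n y (hL₁ y hy), smul_smul]
    · rw [Submodule.map_le_iff_le_comap, Submodule.mul_le]
      rintro a ha _ ⟨y, hy, rfl⟩
      refine Submodule.subset_span ⟨a • d n, ih ▸ ⟨a, ha, rfl⟩, y, hy, ?_⟩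
      simp [h.lie_eq n y (hL₁ y hy), smul_smul]

theorem exists_generators_of_finrank_eq_two (hdim : Module.finrank F L₁ = 2) :
    ∃ x y : M, L₁ = Submodule.span F {x, y} := by
  have hfin : FiniteDimensional F L₁ := Module.finite_of_finrank_pos (by omega)
  let b := Module.finBasisOfFinrankEq F L₁ hdim
  refine ⟨b 0, b 1, ?_⟩
  have h := congrArg (Submodule.map L₁.subtype) b.span_eq
  rw [Submodule.map_span, Submodule.map_top, Submodule.range_subtype, ← Set.range_comp] at h
  refine h.symm.trans ?_
  congr 1
  ext v
  simp [eq_comm]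

theorem gradedPieces_two (E : Type*) [Field E] [Algebra F E] [LieAlgebra E M]
    [IsScalarTower F E M] {x y : M} (hxy : L₁ = Submodule.span F {x, y}) :
    gradedPieces F L₁ 2 = Submodule.span F {⁅x, y⁆} := by
  have hsmul_lie : ∀ (a : F) (u v : M), ⁅a • u, v⁆ = a • ⁅u, v⁆ := fun a u v => by
    rw [← algebraMap_smul E a u, smul_lie, algebraMap_smul]
  have hlie_smul : ∀ (a : F) (u v : M), ⁅u, a • v⁆ = a • ⁅u, v⁆ := fun a u v => by
    rw [← algebraMap_smul E a v, lie_smul, algebraMap_smul]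
  apply le_antisymm
  · refine Submodule.span_le.2 ?_
    rintro _ ⟨u, hu, v, hv, rfl⟩
    change u ∈ L₁ at hu
    rw [hxy] at hu hv
    obtain ⟨a, b, rfl⟩ := Submodule.mem_span_pair.1 hu
    obtain ⟨a', b', rfl⟩ := Submodule.mem_span_pair.1 hv
    refine Submodule.mem_span_singleton.2 ⟨a * b' - b * a', ?_⟩
    simp only [add_lie, lie_add, hsmul_lie, hlie_smul, lie_self, smul_zero, ← lie_skew x y]
    module
  · rw [Submodule.span_singleton_le_iff_mem]
    refine Submodule.subset_span ⟨x, ?_, y, ?_, rfl⟩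
    · change x ∈ L₁
      exact hxy ▸ Submodule.subset_span (by simp)
    · exact hxy ▸ Submodule.subset_span (by simp)

theorem IsMaxClass.lie_generators_ne_zero (hM : IsMaxClass E Mgr) {x y : M}
    (hxy : Mgr 1 = Submodule.span E {x, y}) : ⁅x, y⁆ ≠ 0 := by
  intro h0
  have hgen : Mgr 2 = gradedPieces E (Mgr 1) 2 := hM.graded.gen 1 le_rfl
  have := hM.dim_ge_two 2 le_rfl
  rw [hgen, gradedPieces_two E hxy, h0, Submodule.span_zero_singleton, finrank_bot] at this
  omega

theorem IsGradedIdealFam.two_ne_bot {x y : M} (hxy : L₁ = Submodule.span F {x, y})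
    (E : Type*) [Field E] [Algebra F E] [LieAlgebra E M] [IsScalarTower F E M]
    (h0 : ⁅x, y⁆ ≠ 0) {J : ℕ → Submodule F M} (hJ : IsGradedIdealFam F (gradedPieces F L₁) J)
    (h1 : J 1 ≠ ⊥) : J 2 ≠ ⊥ := by
  intro h2
  have hsmul_lie : ∀ (a : F) (u v : M), ⁅a • u, v⁆ = a • ⁅u, v⁆ := fun a u v => by
    rw [← algebraMap_smul E a u, smul_lie, algebraMap_smul]
  obtain ⟨v, hv, hv0⟩ := Submodule.exists_mem_ne_zero_of_ne_bot h1
  have hbr : ∀ u ∈ L₁, ⁅v, u⁆ = 0 := fun u hu =>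
    (Submodule.mem_bot F).1 (h2 ▸ hJ.2 1 1 v hv u hu)
  have hvL : v ∈ L₁ := hJ.1 1 hv
  rw [hxy] at hvL
  obtain ⟨a, b, rfl⟩ := Submodule.mem_span_pair.1 hvL
  have hx := hbr x (hxy ▸ Submodule.subset_span (by simp))
  have hy := hbr y (hxy ▸ Submodule.subset_span (by simp))
  simp only [add_lie, hsmul_lie, lie_self, smul_zero, zero_add, add_zero] at hx hy
  rw [← lie_skew, smul_neg, neg_eq_zero] at hx
  apply hv0
  rw [(smul_eq_zero.1 hx).resolve_right h0, (smul_eq_zero.1 hy).resolve_right h0]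
  simp

end Descent

theorem dim_two_constrained (F E : Type*) [Field F] [Field E] [Algebra F E]
    (M : Type*) [LieRing M] [LieAlgebra E M] [Module F M] [IsScalarTower F E M]
    (Mgr : ℕ → Submodule E M) (hM : IsMaxClass E Mgr)
    (L₁ : Submodule F M) (hL₁fin : FiniteDimensional F ↥L₁)
    (hdim : Module.finrank F ↥L₁ = 2)
    (hL₁ : (L₁ : Set M) ⊆ (Mgr 1 : Set M))
    (hspan : Submodule.span E (L₁ : Set M) = Mgr 1)
    (Ffield : ℕ → IntermediateField F E)
    (hFf : ∀ i, 2 ≤ i → ∀ φ : M →ₗ[E] E,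
      (∀ v ∈ Mgr 1, (φ v = 0 ↔ v ∈ twoStepCent E Mgr i)) →
      (1 : E) ∈ ⇑φ '' (L₁ : Set M) →
      Ffield i = IntermediateField.adjoin F (⇑φ '' (L₁ : Set M)))
    (K : IntermediateField F E)
    (hK : K = ⨆ i : {n : ℕ // 2 ≤ n}, Ffield i)
    (hKfin : FiniteDimensional F ↥K) :
    ∃ r : ℕ, 1 ≤ r ∧ IdeallyConstrained F (gradedPieces F L₁) r := by
  obtain ⟨x, y, hxy⟩ := exists_generators_of_finrank_eq_two hdim
  have hM1 : Mgr 1 = Submodule.span E {x, y} := by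
    rw [← hspan, hxy, Submodule.span_span_of_tower]
  have hx : x ∈ Mgr 1 := hM1 ▸ Submodule.subset_span (by simp)
  have hy : y ∈ Mgr 1 := hM1 ▸ Submodule.subset_span (by simp)
  have hne := hM.lie_generators_ne_zero hM1
  obtain ⟨d, l, φ, h, hd0⟩ := hM.exists_isAdaptedBasis hspan
    (hM.graded.bracket_mem 1 1 x hx y hy) hne
  have hgr := gradedPieces_eq_map h hL₁ (by rw [gradedPieces_two E hxy, hd0])
  set P : ℕ → Submodule F E := fun k => L₁.map ((φ k).restrictScalars F)
  have hPK : ∀ n, P n ≤ Subalgebra.toSubmodule K.toSubalgebra := by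
    rintro n _ ⟨v, hv, rfl⟩
    have hFn := hFf (n + 2) (by omega) (φ n) (fun v hv => h.apply_eq_zero_iff n hv)
      ⟨l n, h.l_mem n, h.apply_l n⟩
    have hle : Ffield (n + 2) ≤ K :=
      hK ▸ le_iSup (fun i : {n : ℕ // 2 ≤ n} => Ffield i) ⟨n + 2, by omega⟩
    exact hle (hFn ▸ IntermediateField.subset_adjoin F _ ⟨v, hv, rfl⟩)
  have hWK : ∀ n, ∏ k ∈ Finset.range n, P k ≤ Subalgebra.toSubmodule K.toSubalgebra := by
    intro n
    induction n with
    | zero =>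
      rw [Finset.range_zero, Finset.prod_empty, Submodule.one_le]
      exact K.one_mem
    | succ n ih =>
      rw [Finset.prod_range_succ]
      exact Submodule.mul_le.2 fun a ha b hb => K.mul_mem (ih ha) (hPK n hb)
  have hrec : ∀ m, ∃ B, ∀ n, ∃ j, n ≤ j ∧ j ≤ n + B ∧
      ∃ c : E, c ≠ 0 ∧ ∀ a ∈ P m, c * a ∈ P j := by
    refine fun m => ⟨m + 2, fun n => ?_⟩
    obtain ⟨j, hj, hj', c, hc, hφ⟩ := h.exists_proportional hM hL₁ m n
    refine ⟨j, hj, hj', c, hc, ?_⟩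
    rintro _ ⟨v, hv, rfl⟩
    exact ⟨v, hv, hφ v (hL₁ hv)⟩
  have hKfin' : FiniteDimensional F (Subalgebra.toSubmodule K.toSubalgebra) := hKfin
  obtain ⟨R, hR⟩ := eq_prod_of_recurrent (P := P) (Subalgebra.toSubmodule K.toSubalgebra)
    (fun n => ⟨l n, h.l_mem n, h.apply_l n⟩) hWK hrec
  refine ⟨R + 1, by omega, fun J hJ hJne => ?_⟩
  have hinj : ∀ n, Function.Injective
      ((LinearMap.toSpanSingleton E M (d n)).restrictScalars F) := fun n =>
    smul_left_injective E (h.ne_zero n)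
  let V : ℕ → Submodule F E := fun n =>
    (J (n + 2)).comap ((LinearMap.toSpanSingleton E M (d n)).restrictScalars F)
  have hVW : ∀ n, V n ≤ ∏ k ∈ Finset.range n, P k := by
    intro n a ha
    have hmem := hJ.1 (n + 2) ha
    rw [hgr] at hmem
    obtain ⟨b, hb, hab⟩ := hmem
    exact hinj n hab ▸ hb
  have hVP : ∀ n, V n * P n ≤ V (n + 1) := by
    intro n
    refine Submodule.mul_le.2 ?_
    rintro a ha _ ⟨v, hv, rfl⟩
    have hmem := hJ.2 (n + 2) 1 _ ha v hv
    have hav : ⁅a • d n, v⁆ = (a * φ n v) • d (n + 1) := by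
      rw [smul_lie, h.lie_eq n v (hL₁ hv), smul_smul]
    change (a * φ n v) • d (n + 1) ∈ J (n + 1 + 2)
    rw [← hav]
    exact hmem
  have hVne : ∀ n, J (n + 2) ≠ ⊥ → V n ≠ ⊥ := by
    intro n hn hbot
    obtain ⟨v, hv, hv0⟩ := Submodule.exists_mem_ne_zero_of_ne_bot hn
    have hmem := hJ.1 (n + 2) hv
    rw [hgr] at hmem
    obtain ⟨a, -, rfl⟩ := hmem
    have ha : a ∈ V n := hv
    rw [hbot, Submodule.mem_bot] at ha
    exact hv0 (by rw [ha, map_zero])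
  have htop : ∀ n, J (n + 2) ≠ ⊥ → ∀ j, n + 2 + R ≤ j → J j = gradedPieces F L₁ j := by
    intro n hn j hj
    obtain ⟨k, rfl⟩ : ∃ k, j = k + 2 := ⟨j - 2, by omega⟩
    refine le_antisymm (hJ.1 _) ?_
    rw [hgr, ← hR V hVP hVW n (hVne n hn) k (by omega)]
    exact Submodule.map_comap_le _ _
  classical
  refine ⟨Nat.find hJne, fun j hj => not_not.1 (Nat.find_min hJne hj), ?_⟩
  have hi := Nat.find_spec hJne
  generalize Nat.find hJne = i at hi
  match i, hi with
  | 0, hi => exact absurd (le_bot_iff.1 (hJ.1 0)) hi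
  | 1, hi => exact fun j hj => htop 0 (hJ.two_ne_bot hxy E hne hi) j (by omega)
  | n + 2, hi => exact fun j hj => htop n hi j (by omega)
end
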